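/- There exists a numerical constant C > 0 such that for every n ≥ 2 and every smooth function f : 𝕊^{n−1} → ℝ with |f| ≤ 1, Var_μ(f) ≤ (C/√n) · Σ_{i,j=1}^n ‖D_{ij} f‖₁ (1 + ‖D_{ij} f‖₁) / [1 + log⁺(1/‖D_{ij} f‖₁)]^{1/2}. -/

import Mathlib

open MeasureTheory

/-- The uniform (normalized) probability measure on the unit sphere of `ℝ^n`. -/
noncomputable def sphereUniform (n : ℕ) :
    Measure (Metric.sphere (0 : EuclideanSpace ℝ (Fin n)) 1) :=
  ((volume : Measure (EuclideanSpace ℝ (Fin n))).toSphere Set.univ)⁻¹ •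
    (volume : Measure (EuclideanSpace ℝ (Fin n))).toSphere

/-- The angular derivative `D_{ij} f = x_i ∂_j f - x_j ∂_i f`, computed on a smooth
extension `F` of `f` to `ℝ^n` (it is intrinsic to the sphere). -/
noncomputable def Dang (n : ℕ) (i j : Fin n) (F : EuclideanSpace ℝ (Fin n) → ℝ)
    (x : EuclideanSpace ℝ (Fin n)) : ℝ :=
  x i * fderiv ℝ F x (EuclideanSpace.single j 1) -
    x j * fderiv ℝ F x (EuclideanSpace.single i 1)

/-- `L^p` norm on the sphere with respect to the uniform probability measure. -/
noncomputable def sphNorm (n : ℕ) (p : ℝ) (g : EuclideanSpace ℝ (Fin n) → ℝ) : ℝ :=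
  (∫ x, |g (x : EuclideanSpace ℝ (Fin n))| ^ p ∂sphereUniform n) ^ (1 / p)

/-- Variance on the sphere with respect to the uniform probability measure. -/
noncomputable def sphVar (n : ℕ) (g : EuclideanSpace ℝ (Fin n) → ℝ) : ℝ :=
  (∫ x, g (x : EuclideanSpace ℝ (Fin n)) ^ 2 ∂sphereUniform n) -
    (∫ x, g (x : EuclideanSpace ℝ (Fin n)) ∂sphereUniform n) ^ 2

section SphereTalagrand

open ProbabilityTheory
open scoped ENNReal

section Gaussian
variable {E : Type*} [NormedAddCommGroup E] [InnerProductSpace ℝ E] [FiniteDimensional ℝ E]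
  [MeasurableSpace E] [BorelSpace E]

theorem lintegral_mul_sq_le {α : Type*} [MeasurableSpace α] (μ : Measure α) {f g : α → ℝ≥0∞}
    (hf : AEMeasurable f μ) (hg : AEMeasurable g μ) :
    (∫⁻ x, f x * g x ∂μ) ^ 2 ≤ (∫⁻ x, f x ^ 2 ∂μ) * ∫⁻ x, g x ^ 2 ∂μ := by
  have h := ENNReal.lintegral_mul_le_Lp_mul_Lq μ Real.HolderConjugate.two_two hf hg
  simp only [Pi.mul_apply, ENNReal.rpow_ofNat] at h
  calc _ ≤ ((∫⁻ x, f x ^ 2 ∂μ) ^ (1 / 2 : ℝ) * (∫⁻ x, g x ^ 2 ∂μ) ^ (1 / 2 : ℝ)) ^ 2 := by gcongr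
    _ = _ := by
      rw [mul_pow, ← ENNReal.rpow_natCast, ← ENNReal.rpow_natCast, ← ENNReal.rpow_mul,
        ← ENNReal.rpow_mul]
      norm_num

/-- A triangle form of Finner's inequality. -/
theorem lintegral_triangle_sq_le {α : Type*} [MeasurableSpace α] (μ : Measure α) [SFinite μ]
    {p q r : α → α → ℝ≥0∞} (hp : Measurable (Function.uncurry p))
    (hq : Measurable (Function.uncurry q)) (hr : Measurable (Function.uncurry r)) :
    (∫⁻ a, ∫⁻ b, ∫⁻ c, p a b * (q a c * r b c) ∂μ ∂μ ∂μ) ^ 2 ≤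
      (∫⁻ a, ∫⁻ b, p a b ^ 2 ∂μ ∂μ) * ((∫⁻ a, ∫⁻ b, q a b ^ 2 ∂μ ∂μ) *
        ∫⁻ a, ∫⁻ b, r a b ^ 2 ∂μ ∂μ) := by
  have hqa : ∀ a, Measurable (q a) := fun a => hq.comp measurable_prodMk_left
  have hra : ∀ a, Measurable (r a) := fun a => hr.comp measurable_prodMk_left
  have hpa : ∀ a, Measurable (p a) := fun a => hp.comp measurable_prodMk_left
  have hqr : Measurable (fun z : α × α => ∫⁻ c, q z.1 c * r z.2 c ∂μ) := by
    refine Measurable.lintegral_prod_right' (f := fun w : (α × α) × α => q w.1.1 w.2 * r w.1.2 w.2) ?_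
    exact (hq.comp (by fun_prop : Measurable fun w : (α × α) × α => (w.1.1, w.2))).mul
      (hr.comp (by fun_prop : Measurable fun w : (α × α) × α => (w.1.2, w.2)))
  have h1 : (∫⁻ a, ∫⁻ b, ∫⁻ c, p a b * (q a c * r b c) ∂μ ∂μ ∂μ) =
      ∫⁻ z, p z.1 z.2 * ∫⁻ c, q z.1 c * r z.2 c ∂μ ∂(μ.prod μ) := by
    rw [lintegral_prod (fun z => p z.1 z.2 * ∫⁻ c, q z.1 c * r z.2 c ∂μ) (hp.mul hqr).aemeasurable]
    refine lintegral_congr fun a => lintegral_congr fun b => ?_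
    exact lintegral_const_mul _ ((hqa a).mul (hra b))
  have h2 : (∫⁻ a, ∫⁻ b, p a b ^ 2 ∂μ ∂μ) = ∫⁻ z, p z.1 z.2 ^ 2 ∂(μ.prod μ) := by
    rw [lintegral_prod (fun z => p z.1 z.2 ^ 2) (hp.pow_const 2).aemeasurable]
  rw [h1, h2]
  refine (lintegral_mul_sq_le _ hp.aemeasurable hqr.aemeasurable).trans ?_
  refine mul_le_mul' le_rfl ?_
  calc ∫⁻ z, (∫⁻ c, q z.1 c * r z.2 c ∂μ) ^ 2 ∂(μ.prod μ)
      ≤ ∫⁻ z, (∫⁻ c, q z.1 c ^ 2 ∂μ) * (∫⁻ c, r z.2 c ^ 2 ∂μ) ∂(μ.prod μ) :=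
        lintegral_mono fun z =>
          lintegral_mul_sq_le _ (hqa _).aemeasurable (hra _).aemeasurable
    _ = _ := by
      refine lintegral_prod_mul (f := fun a => ∫⁻ c, q a c ^ 2 ∂μ)
        (g := fun a => ∫⁻ c, r a c ^ 2 ∂μ) ?_ ?_
      · exact (Measurable.lintegral_prod_right' (hq.pow_const 2)).aemeasurable
      · exact (Measurable.lintegral_prod_right' (hr.pow_const 2)).aemeasurable

/-- Rotation in `E × E`. -/
def rot (c s : ℝ) (p : E × E) : E × E := (c • p.1 + s • p.2, -s • p.1 + c • p.2)

theorem measurable_rot (c s : ℝ) : Measurable (rot (E := E) c s) := by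
  unfold rot; fun_prop

theorem measurePreserving_rot {c s : ℝ} (h : c ^ 2 + s ^ 2 = 1) :
    MeasurePreserving (rot c s) ((stdGaussian E).prod (stdGaussian E))
      ((stdGaussian E).prod (stdGaussian E)) := by
  refine ⟨measurable_rot c s, ?_⟩
  let R : (E × E) →L[ℝ] (E × E) :=
    (c • ContinuousLinearMap.fst ℝ E E + s • ContinuousLinearMap.snd ℝ E E).prod
      (-s • ContinuousLinearMap.fst ℝ E E + c • ContinuousLinearMap.snd ℝ E E)
  have hR : (rot c s : E × E → E × E) = R := by
    ext p <;> simp [rot, R]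
  rw [hR]
  apply Measure.ext_of_charFunDual
  ext L
  rw [charFunDual_map, charFunDual_prod, charFunDual_prod]
  simp only [charFunDual_stdGaussian]
  rw [← Complex.exp_add, ← Complex.exp_add]
  congr 1
  set L1 := L.comp (ContinuousLinearMap.inl ℝ E E) with hL1
  set L2 := L.comp (ContinuousLinearMap.inr ℝ E E) with hL2
  have e1 : (L.comp R).comp (ContinuousLinearMap.inl ℝ E E) = c • L1 - s • L2 := by
    ext x
    have : R (x, 0) = c • ((x, 0) : E × E) - s • ((0, x) : E × E) := by simp [R]
    change L (R (x, 0)) = c • L (x, 0) - s • L (0, x)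
    rw [this, map_sub, map_smul, map_smul]
  have e2 : (L.comp R).comp (ContinuousLinearMap.inr ℝ E E) = s • L1 + c • L2 := by
    ext x
    have : R (0, x) = s • ((x, 0) : E × E) + c • ((0, x) : E × E) := by simp [R]
    change L (R (0, x)) = s • L (x, 0) + c • L (0, x)
    rw [this, map_add, map_smul, map_smul]
  rw [e1, e2]
  have key : ‖c • L1 - s • L2‖ ^ 2 + ‖s • L1 + c • L2‖ ^ 2 = ‖L1‖ ^ 2 + ‖L2‖ ^ 2 := by
    obtain ⟨v1, h1⟩ := (InnerProductSpace.toDual ℝ E).surjective L1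
    obtain ⟨v2, h2⟩ := (InnerProductSpace.toDual ℝ E).surjective L2
    have a1 : c • L1 - s • L2 = InnerProductSpace.toDual ℝ E (c • v1 - s • v2) := by
      simp [h1, h2]
    have a2 : s • L1 + c • L2 = InnerProductSpace.toDual ℝ E (s • v1 + c • v2) := by
      simp [h1, h2]
    rw [a1, a2, ← h1, ← h2]
    simp only [LinearIsometryEquiv.norm_map]
    rw [@norm_sub_sq ℝ, @norm_add_sq ℝ]
    simp only [norm_smul, real_inner_smul_left, real_inner_smul_right, RCLike.re_to_real, mul_pow,
      Real.norm_eq_abs, sq_abs]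
    linear_combination (‖v1‖ ^ 2 + ‖v2‖ ^ 2) * h
  have key' := congrArg (fun x : ℝ => (x : ℂ)) key
  push_cast at key'
  linear_combination (-1 / 2 : ℂ) * key'

theorem lintegral_rot {c s : ℝ} (h : c ^ 2 + s ^ 2 = 1) {k : E × E → ℝ≥0∞} (hk : Measurable k) :
    ∫⁻ x, ∫⁻ y, k (c • x + s • y, -s • x + c • y) ∂stdGaussian E ∂stdGaussian E =
      ∫⁻ x, ∫⁻ y, k (x, y) ∂stdGaussian E ∂stdGaussian E := by
  have h1 := (measurePreserving_rot (E := E) h).lintegral_comp hk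
  rw [lintegral_prod (fun p => k (rot c s p)) (hk.comp (measurable_rot c s)).aemeasurable,
    lintegral_prod _ hk.aemeasurable] at h1
  exact h1

theorem lintegral_comb {c s : ℝ} (h : c ^ 2 + s ^ 2 = 1) {k : E → ℝ≥0∞} (hk : Measurable k) :
    ∫⁻ x, ∫⁻ y, k (c • x + s • y) ∂stdGaussian E ∂stdGaussian E = ∫⁻ x, k x ∂stdGaussian E := by
  have := lintegral_rot h (k := fun p => k p.1) (hk.comp measurable_fst)
  simpa using this

end Gaussian

section Gaussian
variable {E : Type*} [NormedAddCommGroup E] [InnerProductSpace ℝ E] [FiniteDimensional ℝ E]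
  [MeasurableSpace E] [BorelSpace E]

theorem lintegral_hypercontractive_aux {c s k : ℝ} (h : c ^ 2 + s ^ 2 = 1) (hk : k ^ 2 + k ^ 2 = 1)
    (hsk : s * k = c) {u : E → ℝ≥0∞} (hu : Measurable u) :
    (∫⁻ x, u x * (∫⁻ y, u (c • x + s • y) ∂stdGaussian E) ^ 2 ∂stdGaussian E) ^ 2 ≤
      (∫⁻ x, u x ^ 2 ∂stdGaussian E) ^ 3 := by
  set γ := stdGaussian E with hγ
  have e1 : ∀ x, u x * (∫⁻ y, u (c • x + s • y) ∂γ) ^ 2 =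
      ∫⁻ y, ∫⁻ z, u x * (u (c • x + (s * k) • (y + z)) * u (c • x + (s * k) • (z - y))) ∂γ ∂γ := by
    intro x
    have hv : Measurable (fun y => u (c • x + s • y)) := by fun_prop
    have hvv : Measurable (fun p : E × E => u (c • x + s • p.1) * u (c • x + s • p.2)) := by fun_prop
    have := lintegral_rot (E := E) hk hvv
    simp only at this
    rw [sq, ← lintegral_prod_mul hv.aemeasurable hv.aemeasurable,
      lintegral_prod _ hvv.aemeasurable, ← this, ← lintegral_const_mul]
    · refine lintegral_congr fun y => ?_
      rw [← lintegral_const_mul _ (by fun_prop)]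
      refine lintegral_congr fun z => ?_
      congr 4 <;> module
    · refine Measurable.lintegral_prod_right' (f := fun p : E × E => u (c • x + s • (k • p.1 + k • p.2)) *
        u (c • x + s • (-k • p.1 + k • p.2))) (by fun_prop)
  have hΨ : Measurable (fun p : E × E => ∫⁻ z, u p.1 * (u (c • p.1 + (s * k) • (p.2 + z)) *
      u (c • p.1 + (s * k) • (z - p.2))) ∂γ) := by
    refine Measurable.lintegral_prod_right' (f := fun w : (E × E) × E => u w.1.1 *
      (u (c • w.1.1 + (s * k) • (w.1.2 + w.2)) *
      u (c • w.1.1 + (s * k) • (w.2 - w.1.2)))) (by fun_prop)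
  rw [lintegral_congr e1, ← lintegral_rot hk hΨ]
  have e2 : ∀ x y z : E, u (k • x + k • y) *
      (u (c • (k • x + k • y) + (s * k) • (-k • x + k • y + z)) *
        u (c • (k • x + k • y) + (s * k) • (z - (-k • x + k • y)))) =
      u (k • x + k • y) * (u (s • x + c • z) * u (s • y + c • z)) := by
    intro x y z
    have hck : c * k + (s * k) * k = s := by rw [← hsk]; linear_combination s * hk
    have hck' : c * k - (s * k) * k = 0 := by rw [← hsk]; ring
    have a1 : c • (k • x + k • y) + (s * k) • (-k • x + k • y + z) = s • y + c • z := by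
      rw [show c • (k • x + k • y) + (s * k) • (-k • x + k • y + z) =
        (c * k - s * k * k) • x + (c * k + s * k * k) • y + (s * k) • z by module, hck, hck', hsk]
      simp
    have a2 : c • (k • x + k • y) + (s * k) • (z - (-k • x + k • y)) = s • x + c • z := by
      rw [show c • (k • x + k • y) + (s * k) • (z - (-k • x + k • y)) =
        (c * k + s * k * k) • x + (c * k - s * k * k) • y + (s * k) • z by module, hck, hck', hsk]
      simp
    rw [a1, a2, mul_comm (u (s • y + c • z))]
  simp only [e2]
  refine (lintegral_triangle_sq_le γ (p := fun x y => u (k • x + k • y))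
    (q := fun x z => u (s • x + c • z)) (r := fun y z => u (s • y + c • z)) ?_ ?_ ?_).trans ?_
  · unfold Function.uncurry; fun_prop
  · unfold Function.uncurry; fun_prop
  · unfold Function.uncurry; fun_prop
  · rw [lintegral_comb hk (k := fun x => u x ^ 2) (by fun_prop),
      lintegral_comb (by linarith) (k := fun x => u x ^ 2) (by fun_prop)]
    exact le_of_eq (by ring)

/-- Hypercontractivity of the Mehler kernel with correlation `c` where `3 c² = 1`, in bilinear
form. -/
theorem lintegral_hypercontractive {c s k : ℝ} (h : c ^ 2 + s ^ 2 = 1) (hk : k ^ 2 + k ^ 2 = 1)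
    (hsk : s * k = c) {u : E → ℝ≥0∞} (hu : Measurable u) :
    (∫⁻ x, u x * (∫⁻ y, u (c • x + s • y) ∂stdGaussian E) ∂stdGaussian E) ^ 4 ≤
      (∫⁻ x, u x ∂stdGaussian E) ^ 2 * (∫⁻ x, u x ^ 2 ∂stdGaussian E) ^ 3 := by
  set γ := stdGaussian E with hγ
  have hq : Measurable (fun x => ∫⁻ y, u (c • x + s • y) ∂γ) :=
    Measurable.lintegral_prod_right' (f := fun p : E × E => u (c • p.1 + s • p.2)) (by fun_prop)
  have hsq : ∀ a : ℝ≥0∞, a ^ (1 / 2 : ℝ) * a ^ (1 / 2 : ℝ) = a := fun a => by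
    rw [← ENNReal.rpow_add_of_nonneg _ _ (by norm_num) (by norm_num)]; norm_num
  have h1 : (∫⁻ x, u x * (∫⁻ y, u (c • x + s • y) ∂γ) ∂γ) ^ 2 ≤
      (∫⁻ x, u x ∂γ) * ∫⁻ x, u x * (∫⁻ y, u (c • x + s • y) ∂γ) ^ 2 ∂γ := by
    have := lintegral_mul_sq_le γ (f := fun x => u x ^ (1 / 2 : ℝ))
      (g := fun x => u x ^ (1 / 2 : ℝ) * ∫⁻ y, u (c • x + s • y) ∂γ)
      (hu.pow_const _).aemeasurable ((hu.pow_const _).mul hq).aemeasurable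
    simpa only [← mul_assoc, hsq, mul_pow, sq (_ ^ (1 / 2 : ℝ))] using this
  calc _ = ((∫⁻ x, u x * (∫⁻ y, u (c • x + s • y) ∂γ) ∂γ) ^ 2) ^ 2 := by ring
    _ ≤ ((∫⁻ x, u x ∂γ) * ∫⁻ x, u x * (∫⁻ y, u (c • x + s • y) ∂γ) ^ 2 ∂γ) ^ 2 := by gcongr
    _ ≤ _ := by
      rw [mul_pow]
      refine mul_le_mul' le_rfl ?_
      exact lintegral_hypercontractive_aux h hk hsk hu

end Gaussian

theorem integrable_of_abs_le {α : Type*} [MeasurableSpace α] {μ : Measure α} [IsFiniteMeasure μ]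
    {f : α → ℝ} (hf : Measurable f) {M : ℝ} (hb : ∀ x, |f x| ≤ M) : Integrable f μ :=
  Integrable.of_bound hf.aestronglyMeasurable M (Filter.Eventually.of_forall hb)

theorem integral_mul_sq_le {α : Type*} [MeasurableSpace α] {μ : Measure α}
    {f g : α → ℝ} (hf : Integrable (fun x => f x ^ 2) μ) (hg : Integrable (fun x => g x ^ 2) μ)
    (hfg : Integrable (fun x => f x * g x) μ) :
    (∫ x, f x * g x ∂μ) ^ 2 ≤ (∫ x, f x ^ 2 ∂μ) * ∫ x, g x ^ 2 ∂μ := by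
  have h : ∀ t : ℝ, 0 ≤ (∫ x, f x ^ 2 ∂μ) * (t * t) + (-(2 * ∫ x, f x * g x ∂μ)) * t +
      ∫ x, g x ^ 2 ∂μ := by
    intro t
    have h0 : 0 ≤ ∫ x, (t * f x - g x) ^ 2 ∂μ := integral_nonneg fun x => sq_nonneg _
    have h1 : (fun x => (t * f x - g x) ^ 2) =
        fun x => t ^ 2 * f x ^ 2 - 2 * t * (f x * g x) + g x ^ 2 := by ext x; ring
    have h2 : Integrable (fun x => t ^ 2 * f x ^ 2 - 2 * t * (f x * g x)) μ :=
      (hf.const_mul _).sub (hfg.const_mul _)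
    rw [h1, integral_add h2 hg,
      integral_sub (hf.const_mul _) (hfg.const_mul _), integral_const_mul, integral_const_mul] at h0
    linarith
  have := discrim_le_zero h
  unfold discrim at this
  linarith

section Gaussian
variable {E : Type*} [NormedAddCommGroup E] [InnerProductSpace ℝ E] [FiniteDimensional ℝ E]
  [MeasurableSpace E] [BorelSpace E]

theorem integral_rot {c s : ℝ} (h : c ^ 2 + s ^ 2 = 1) {k : E × E → ℝ} (hk : Measurable k) :
    ∫ p, k (rot c s p) ∂(stdGaussian E).prod (stdGaussian E) =
      ∫ p, k p ∂(stdGaussian E).prod (stdGaussian E) := by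
  have hm := measurePreserving_rot (E := E) h
  conv_rhs => rw [← hm.map_eq]
  rw [integral_map hm.measurable.aemeasurable hk.aestronglyMeasurable]

theorem integral_comb {c s : ℝ} (h : c ^ 2 + s ^ 2 = 1) {k : E → ℝ} (hk : Measurable k) :
    ∫ p : E × E, k (c • p.1 + s • p.2) ∂(stdGaussian E).prod (stdGaussian E) =
      ∫ x, k x ∂stdGaussian E := by
  have := integral_rot h (k := fun p => k p.1) (hk.comp measurable_fst)
  rw [integral_fun_fst] at this
  simpa [rot] using this

/-- The correlation of `h` along a standard Gaussian pair. -/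
noncomputable def gaussCorr (h : E → ℝ) (c s : ℝ) : ℝ :=
  ∫ p : E × E, h p.1 * h (c • p.1 + s • p.2) ∂(stdGaussian E).prod (stdGaussian E)

/-- Log-convexity of correlations along the Mehler semigroup. -/
theorem gaussCorr_sq_le {c s t M : ℝ} (hcs : c ^ 2 + s ^ 2 = 1) (ht : 0 < t)
    (hct : (c ^ 2) ^ 2 + t ^ 2 = 1) {h : E → ℝ} (hm : Measurable h) (hM : ∀ x, |h x| ≤ M) :
    gaussCorr h c s ^ 2 ≤ (∫ x, h x ^ 2 ∂stdGaussian E) * gaussCorr h (c ^ 2) t := by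
  set γ := stdGaussian E with hγ
  have hM0 : 0 ≤ M := (abs_nonneg _).trans (hM 0)
  have hMM : ∀ x y, |h x * h y| ≤ M * M := fun x y => by
    rw [abs_mul]; exact mul_le_mul (hM x) (hM y) (abs_nonneg _) hM0
  set q : E → ℝ := fun x => ∫ y, h (c • x + s • y) ∂γ with hq
  have hqm : Measurable q :=
    (StronglyMeasurable.integral_prod_right'
      (f := fun p : E × E => h (c • p.1 + s • p.2))
      (by fun_prop : Measurable _).stronglyMeasurable).measurable
  have hqM : ∀ x, |q x| ≤ M := fun x => by
    have := norm_integral_le_of_norm_le_const (μ := γ) (f := fun y => h (c • x + s • y)) (C := M)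
      (Filter.Eventually.of_forall fun y => hM _)
    simpa using this
  have hb : gaussCorr h c s = ∫ x, h x * q x ∂γ := by
    unfold gaussCorr
    rw [integral_prod _ (integrable_of_abs_le (M := M * M) (by fun_prop) fun p => hMM _ _)]
    refine integral_congr_ae (Filter.Eventually.of_forall fun x => ?_)
    simp only [hq]
    rw [integral_const_mul]
  have hsq : ∀ {f : E → ℝ}, Measurable f → (∀ x, |f x| ≤ M) → Integrable (fun x => f x ^ 2) γ :=
    fun hf hfM => integrable_of_abs_le (M := M ^ 2) (by fun_prop) fun x => by
      rw [abs_pow]; exact pow_le_pow_left₀ (abs_nonneg _) (hfM x) 2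
  have hqq : ∫ x, q x ^ 2 ∂γ = gaussCorr h (c ^ 2) t := by
    have e1 : ∀ x, q x ^ 2 = ∫ z, h (c • x + s • z.1) * h (c • x + s • z.2) ∂γ.prod γ := fun x => by
      rw [sq, ← integral_prod_mul]
    have hΦ : Measurable (fun w : (E × E) × E => h (c • w.1.1 + s • w.1.2) * h (c • w.1.1 + s • w.2)) := by
      fun_prop
    have hmeas3 : ∀ {f : E × E × E → ℝ}, Measurable f → (∀ w, |f w| ≤ M * M) →
        Integrable f (γ.prod (γ.prod γ)) := fun hf hfM => integrable_of_abs_le hf hfM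
    have hmeas3' : ∀ {f : E × E × E → ℝ}, Measurable f → (∀ w, |f w| ≤ M * M) →
        ∫ x, ∫ z, f (x, z) ∂γ.prod γ ∂γ = ∫ z, ∫ p, f (p.1, p.2, z) ∂γ.prod γ ∂γ := by
      intro f hf hfM
      rw [← integral_prod _ (hmeas3 hf hfM), ← (measurePreserving_prodAssoc γ γ γ).integral_comp'
        (f := MeasurableEquiv.prodAssoc),
        integral_prod_symm]
      · rfl
      · exact integrable_of_abs_le (by fun_prop) fun w => hfM _
    simp only [e1]
    rw [hmeas3' (f := fun w => h (c • w.1 + s • w.2.1) * h (c • w.1 + s • w.2.2)) (by fun_prop)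
      fun w => hMM _ _]
    have hcs' : c ^ 2 + (-s) ^ 2 = 1 := by linarith
    have e2 : ∀ z : E, ∫ p : E × E, h (c • p.1 + s • p.2) * h (c • p.1 + s • z) ∂γ.prod γ =
        ∫ p : E × E, h p.1 * h (c ^ 2 • p.1 + (-(c * s)) • p.2 + s • z) ∂γ.prod γ := by
      intro z
      have hk : Measurable (fun p : E × E => h (c • p.1 + s • p.2) * h (c • p.1 + s • z)) := by fun_prop
      rw [← integral_rot hcs' hk]
      refine integral_congr_ae (Filter.Eventually.of_forall fun p => ?_)
      simp only [rot]
      have a1 : c • (c • p.1 + -s • p.2) + s • (- -s • p.1 + c • p.2) = p.1 := by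
        rw [show c • (c • p.1 + -s • p.2) + s • (- -s • p.1 + c • p.2) = (c ^ 2 + s ^ 2) • p.1 by module,
          hcs, one_smul]
      have a2 : c • (c • p.1 + -s • p.2) + s • z = c ^ 2 • p.1 + (-(c * s)) • p.2 + s • z := by module
      rw [a1, a2]
    simp only [e2]
    rw [← hmeas3' (f := fun w => h w.1 * h (c ^ 2 • w.1 + (-(c * s)) • w.2.1 + s • w.2.2)) (by fun_prop)
      fun w => hMM _ _]
    unfold gaussCorr
    rw [integral_prod _ (integrable_of_abs_le (M := M * M) (by fun_prop) fun p => hMM _ _)]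
    refine integral_congr_ae (Filter.Eventually.of_forall fun x => ?_)
    simp only
    rw [integral_const_mul, integral_const_mul]
    congr 1
    have hab : (-(c * s) / t) ^ 2 + (s / t) ^ 2 = 1 := by
      field_simp
      nlinarith
    rw [← integral_comb hab (k := fun y => h (c ^ 2 • x + t • y)) (by fun_prop)]
    refine integral_congr_ae (Filter.Eventually.of_forall fun w => ?_)
    simp only
    congr 1
    rw [smul_add, smul_smul, smul_smul, mul_div_cancel₀ _ ht.ne', mul_div_cancel₀ _ ht.ne', add_assoc]
  rw [hb, ← hqq]
  exact integral_mul_sq_le (hsq hm hM) (hsq hqm hqM) (integrable_of_abs_le (M := M * M) (by fun_prop)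
    fun x => by rw [abs_mul]; exact mul_le_mul (hM x) (hqM x) (abs_nonneg _) hM0)

/-- Hypercontractive bound for the correlation in real form. -/
theorem gaussCorr_pow_le {c s k M : ℝ} (hcs : c ^ 2 + s ^ 2 = 1) (hk : k ^ 2 + k ^ 2 = 1)
    (hsk : s * k = c) {h : E → ℝ} (hm : Measurable h) (hM : ∀ x, |h x| ≤ M) :
    gaussCorr h c s ^ 4 ≤
      (∫ x, |h x| ∂stdGaussian E) ^ 2 * (∫ x, h x ^ 2 ∂stdGaussian E) ^ 3 := by
  set γ := stdGaussian E with hγ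
  have hM0 : 0 ≤ M := (abs_nonneg _).trans (hM 0)
  have hu : Measurable (fun x => ENNReal.ofReal |h x|) := by fun_prop
  have key := lintegral_hypercontractive hcs hk hsk hu
  have i1 : ∫⁻ x, ENNReal.ofReal |h x| ∂γ = ENNReal.ofReal (∫ x, |h x| ∂γ) :=
    (ofReal_integral_eq_lintegral_ofReal (integrable_of_abs_le (M := M) (by fun_prop)
      (by simpa using hM)) (Filter.Eventually.of_forall fun x => abs_nonneg _)).symm
  have i2 : ∫⁻ x, ENNReal.ofReal |h x| ^ 2 ∂γ = ENNReal.ofReal (∫ x, h x ^ 2 ∂γ) := by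
    rw [ofReal_integral_eq_lintegral_ofReal (integrable_of_abs_le (M := M ^ 2) (by fun_prop)
      fun x => by rw [abs_pow]; exact pow_le_pow_left₀ (abs_nonneg _) (hM x) 2)
      (Filter.Eventually.of_forall fun x => sq_nonneg _)]
    refine lintegral_congr fun x => ?_
    rw [← ENNReal.ofReal_pow (abs_nonneg _), sq_abs]
  have i3 : ∫⁻ x, ENNReal.ofReal |h x| * (∫⁻ y, ENNReal.ofReal |h (c • x + s • y)| ∂γ) ∂γ =
      ENNReal.ofReal (∫ p : E × E, |h p.1 * h (c • p.1 + s • p.2)| ∂γ.prod γ) := by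
    rw [ofReal_integral_eq_lintegral_ofReal (integrable_of_abs_le (M := M * M) (by fun_prop)
      fun p => by rw [abs_abs, abs_mul]; exact mul_le_mul (hM _) (hM _) (abs_nonneg _) hM0)
      (Filter.Eventually.of_forall fun x => abs_nonneg _),
      lintegral_prod _ (by fun_prop)]
    refine lintegral_congr fun x => ?_
    rw [← lintegral_const_mul _ (by fun_prop)]
    refine lintegral_congr fun y => ?_
    rw [← ENNReal.ofReal_mul (abs_nonneg _), abs_mul]
  rw [i1, i2, i3, ← ENNReal.ofReal_pow (by positivity), ← ENNReal.ofReal_pow (by positivity),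
    ← ENNReal.ofReal_pow (by positivity), ← ENNReal.ofReal_mul (by positivity),
    ENNReal.ofReal_le_ofReal_iff (by positivity)] at key
  refine le_trans ?_ key
  rw [← (by decide : Even 4).pow_abs]
  gcongr
  exact abs_integral_le_integral_abs

end Gaussian

section Gaussian
variable {E : Type*} [NormedAddCommGroup E] [InnerProductSpace ℝ E] [FiniteDimensional ℝ E]
  [MeasurableSpace E] [BorelSpace E]

/-- The mean `L¹` increment of `g` along a standard Gaussian pair. -/
noncomputable def gaussIncr (g : E → ℝ) (c s : ℝ) : ℝ :=
  ∫ p : E × E, |g p.1 - g (c • p.1 + s • p.2)| ∂(stdGaussian E).prod (stdGaussian E)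

/-- The variance under the standard Gaussian measure. -/
noncomputable def gaussVar (g : E → ℝ) : ℝ :=
  ∫ x, g x ^ 2 ∂stdGaussian E - (∫ x, g x ∂stdGaussian E) ^ 2

variable {g : E → ℝ}

theorem abs_integral_le_one (hg : ∀ x, |g x| ≤ 1) : |∫ x, g x ∂stdGaussian E| ≤ 1 := by
  have := norm_integral_le_of_norm_le_const (μ := stdGaussian E) (f := g) (C := 1)
      (Filter.Eventually.of_forall fun y => hg _)
  simpa using this

theorem abs_sub_mean_le_two (hg : ∀ x, |g x| ≤ 1) (x : E) :
    |g x - ∫ x, g x ∂stdGaussian E| ≤ 2 := by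
  have h1 := abs_integral_le_one hg
  have h2 := hg x
  rw [abs_le] at *
  constructor <;> linarith

theorem integrable_gauss_sq (hm : Measurable g) (hg : ∀ x, |g x| ≤ 1) :
    Integrable (fun x => g x ^ 2) (stdGaussian E) :=
  integrable_of_abs_le (M := 1) (by fun_prop) fun x => by
    rw [abs_pow]; exact pow_le_one₀ (abs_nonneg _) (hg x)

theorem gaussVar_eq (hm : Measurable g) (hg : ∀ x, |g x| ≤ 1) :
    gaussVar g = ∫ x, (g x - ∫ x, g x ∂stdGaussian E) ^ 2 ∂stdGaussian E := by
  set m := ∫ x, g x ∂stdGaussian E with hmdef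
  have h1 : ∀ x, (g x - m) ^ 2 = g x ^ 2 - 2 * m * g x + m ^ 2 := fun x => by ring
  have hi : Integrable g (stdGaussian E) := integrable_of_abs_le hm hg
  have h2 : Integrable (fun x => g x ^ 2 - 2 * m * g x) (stdGaussian E) :=
    (integrable_gauss_sq hm hg).sub (hi.const_mul _)
  simp only [h1]
  rw [integral_add h2 (integrable_const _), integral_sub (integrable_gauss_sq hm hg)
    (hi.const_mul _), integral_const_mul, ← hmdef]
  simp [gaussVar, ← hmdef]
  ring

theorem gaussVar_le_one (hm : Measurable g) (hg : ∀ x, |g x| ≤ 1) : gaussVar g ≤ 1 := by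
  have : ∫ x, g x ^ 2 ∂stdGaussian E ≤ ∫ x, 1 ∂stdGaussian E :=
    integral_mono (integrable_gauss_sq hm hg) (integrable_const _) fun x => by
      rw [← sq_abs]; exact pow_le_one₀ (abs_nonneg _) (hg x)
  simp at this
  unfold gaussVar
  nlinarith [sq_nonneg (∫ x, g x ∂stdGaussian E)]

theorem gaussVar_sub_gaussCorr_le (hm : Measurable g) (hg : ∀ x, |g x| ≤ 1) {c s : ℝ}
    (hcs : c ^ 2 + s ^ 2 = 1) :
    gaussVar g - gaussCorr (fun x => g x - ∫ x, g x ∂stdGaussian E) c s ≤ gaussIncr g c s := by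
  set γ := stdGaussian E with hγ
  set m := ∫ x, g x ∂γ with hmdef
  have hV := gaussVar_eq hm hg
  rw [← hγ, ← hmdef] at hV
  have hh := abs_sub_mean_le_two hg
  rw [← hγ, ← hmdef] at hh
  have hsq : ∀ x, |(g x - m) ^ 2| ≤ 2 ^ 2 := fun x => by
    rw [abs_pow]; exact pow_le_pow_left₀ (abs_nonneg _) (hh x) 2
  have h1 : ∫ p : E × E, (g p.1 - m) ^ 2 ∂γ.prod γ = gaussVar g := by
    rw [hV, integral_fun_fst (f := fun x => (g x - m) ^ 2)]; simp
  have h2 : ∫ p : E × E, (g (c • p.1 + s • p.2) - m) ^ 2 ∂γ.prod γ = gaussVar g := by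
    rw [hV, ← integral_comb hcs (k := fun x => (g x - m) ^ 2) (by fun_prop)]
  have i1 : Integrable (fun p : E × E => (g p.1 - m) ^ 2) (γ.prod γ) :=
    integrable_of_abs_le (by fun_prop) fun p => hsq _
  have i2 : Integrable (fun p : E × E => (g (c • p.1 + s • p.2) - m) ^ 2) (γ.prod γ) :=
    integrable_of_abs_le (by fun_prop) fun p => hsq _
  have i3 : Integrable (fun p : E × E => (g p.1 - m) * (g (c • p.1 + s • p.2) - m)) (γ.prod γ) :=
    integrable_of_abs_le (M := 2 * 2) (by fun_prop) fun p => by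
      rw [abs_mul]; exact mul_le_mul (hh _) (hh _) (abs_nonneg _) (by norm_num)
  have i4 : Integrable (fun p : E × E => 1 / 2 * (g p.1 - m) ^ 2 +
      1 / 2 * (g (c • p.1 + s • p.2) - m) ^ 2) (γ.prod γ) := (i1.const_mul _).add (i2.const_mul _)
  have e : gaussVar g - gaussCorr (fun x => g x - m) c s =
      ∫ p : E × E, (1 / 2 * (g p.1 - m) ^ 2 + 1 / 2 * (g (c • p.1 + s • p.2) - m) ^ 2) -
        (g p.1 - m) * (g (c • p.1 + s • p.2) - m) ∂γ.prod γ := by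
    rw [integral_sub i4 i3, integral_add (i1.const_mul _) (i2.const_mul _), integral_const_mul,
      integral_const_mul, h1, h2]
    unfold gaussCorr
    ring
  rw [e]
  refine integral_mono (i4.sub i3) (integrable_of_abs_le (M := 2) (by fun_prop) fun p => ?_) fun p => ?_
  · rw [abs_abs]
    have a := hg p.1
    have b := hg (c • p.1 + s • p.2)
    rw [abs_le] at *
    constructor <;> linarith
  · simp only
    have a := hg p.1
    have b := hg (c • p.1 + s • p.2)
    have d : |g p.1 - g (c • p.1 + s • p.2)| ≤ 2 := by
      rw [abs_le] at *
      constructor <;> linarith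
    have := mul_le_mul_of_nonneg_left d (abs_nonneg (g p.1 - g (c • p.1 + s • p.2)))
    rw [abs_mul_abs_self] at this
    linarith

theorem integral_abs_sub_mean_le (hm : Measurable g) (hg : ∀ x, |g x| ≤ 1) :
    ∫ x, |g x - ∫ x, g x ∂stdGaussian E| ∂stdGaussian E ≤ gaussIncr g 0 1 := by
  set γ := stdGaussian E with hγ
  have hd : ∀ p : E × E, ‖g p.1 - g p.2‖ ≤ 2 := fun p => by
    have a := hg p.1
    have b := hg p.2
    rw [Real.norm_eq_abs]
    rw [abs_le] at *
    constructor <;> linarith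
  have hi : Integrable (fun p : E × E => g p.1 - g p.2) (γ.prod γ) :=
    integrable_of_abs_le (by fun_prop) hd
  unfold gaussIncr
  simp only [zero_smul, one_smul, zero_add]
  rw [integral_prod _ hi.abs]
  refine integral_mono (integrable_of_abs_le (M := 2) (by fun_prop) fun x => ?_)
    hi.abs.integral_prod_left fun x => ?_
  · rw [abs_abs]; exact abs_sub_mean_le_two hg x
  · simp only
    have : g x - ∫ y, g y ∂γ = ∫ y, (g x - g y) ∂γ := by
      rw [integral_sub (integrable_const _) (integrable_of_abs_le hm hg)]; simp
    rw [this]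
    exact abs_integral_le_integral_abs

theorem gaussVar_le_gaussIncr (hm : Measurable g) (hg : ∀ x, |g x| ≤ 1) :
    gaussVar g ≤ gaussIncr g 0 1 := by
  have h1 := gaussVar_sub_gaussCorr_le hm hg (c := 0) (s := 1) (by norm_num)
  have h2 : gaussCorr (fun x => g x - ∫ x, g x ∂stdGaussian E) 0 1 = 0 := by
    unfold gaussCorr
    simp only [zero_smul, one_smul, zero_add]
    rw [integral_prod_mul (fun x => g x - ∫ x, g x ∂stdGaussian E)
      (fun x => g x - ∫ x, g x ∂stdGaussian E),
      integral_sub (integrable_of_abs_le hm hg) (integrable_const _)]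
    simp
  linarith

theorem gaussIncr_double (hm : Measurable g) (hg : ∀ x, |g x| ≤ 1) (a : ℝ) :
    gaussIncr g (Real.cos (2 * a)) (Real.sin (2 * a)) ≤
      2 * gaussIncr g (Real.cos a) (Real.sin a) := by
  set γ := stdGaussian E with hγ
  have hb : ∀ x y, |(|g x - g y|)| ≤ 2 := fun x y => by
    have a := hg x
    have b := hg y
    rw [abs_abs]
    rw [abs_le] at *
    constructor <;> linarith
  have hrot := integral_rot (E := E) (Real.cos_sq_add_sin_sq a)
    (k := fun p => |g p.1 - g (Real.cos a • p.1 + Real.sin a • p.2)|) (by fun_prop)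
  have e : ∀ p : E × E, Real.cos a • (Real.cos a • p.1 + Real.sin a • p.2) +
      Real.sin a • (-Real.sin a • p.1 + Real.cos a • p.2) =
      Real.cos (2 * a) • p.1 + Real.sin (2 * a) • p.2 := fun p => by
    rw [Real.cos_two_mul', Real.sin_two_mul]; module
  simp only [rot, e] at hrot
  have : 2 * gaussIncr g (Real.cos a) (Real.sin a) =
      ∫ p : E × E, |g p.1 - g (Real.cos a • p.1 + Real.sin a • p.2)| +
       |g (Real.cos a • p.1 + Real.sin a • p.2) -
          g (Real.cos (2 * a) • p.1 + Real.sin (2 * a) • p.2)| ∂γ.prod γ := by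
    rw [integral_add, hrot]
    · unfold gaussIncr; ring
    · exact integrable_of_abs_le (M := 2) (by fun_prop) fun p => hb _ _
    · exact integrable_of_abs_le (M := 2) (by fun_prop) fun p => hb _ _
  rw [this]
  refine integral_mono (integrable_of_abs_le (M := 2) (by fun_prop) fun p => hb _ _)
    ((integrable_of_abs_le (M := 2) (by fun_prop) fun p => hb _ _).add
      (integrable_of_abs_le (M := 2) (by fun_prop) fun p => hb _ _)) fun p => ?_
  exact abs_sub_le _ _ _

end Gaussian

section Gaussian

theorem exists_two_pow_dyadic {L : ℝ} (hL : 8 ≤ L) : ∃ j : ℕ, 8 * 2 ^ j ≤ L ∧ L < 16 * 2 ^ j := by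
  obtain ⟨j, h1, h2⟩ := exists_nat_pow_near (x := L / 8) (y := (2 : ℝ)) (by linarith) (by norm_num)
  refine ⟨j, by linarith, ?_⟩
  rw [pow_succ] at h2
  linarith

variable {E : Type*} [NormedAddCommGroup E] [InnerProductSpace ℝ E] [FiniteDimensional ℝ E]
  [MeasurableSpace E] [BorelSpace E]

/-- The geometric scale of cosines `3 ^ (-1 / 2 ^ (j + 1))`. -/
noncomputable def hyperCos (j : ℕ) : ℝ := Real.exp (-(Real.log 3 / 2 / 2 ^ j))

theorem hyperCos_pos (j : ℕ) : 0 < hyperCos j := Real.exp_pos _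

theorem hyperCos_lt_one (j : ℕ) : hyperCos j < 1 := by
  have : 0 < Real.log 3 := Real.log_pos (by norm_num)
  exact Real.exp_lt_one_iff.2 (by simp only [Left.neg_neg_iff]; positivity)

theorem hyperCos_succ_sq (j : ℕ) : hyperCos (j + 1) ^ 2 = hyperCos j := by
  unfold hyperCos
  rw [← Real.exp_nat_mul]
  congr 1
  rw [pow_succ]
  push_cast
  field_simp

theorem hyperCos_zero_sq : hyperCos 0 ^ 2 = 1 / 3 := by
  unfold hyperCos
  rw [← Real.exp_nat_mul]
  have : ((2 : ℕ) : ℝ) * -(Real.log 3 / 2 / 2 ^ 0) = - Real.log 3 := by push_cast; ring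
  rw [this, Real.exp_neg, Real.exp_log (by norm_num)]
  norm_num

theorem one_sub_hyperCos_le (j : ℕ) : 1 - hyperCos j ≤ 1 / 2 ^ j := by
  have h1 := Real.add_one_le_exp (-(Real.log 3 / 2 / 2 ^ j))
  have h2 : Real.log 3 ≤ 2 := by
    have := Real.log_le_sub_one_of_pos (x := 3) (by norm_num); linarith
  have h3 : Real.log 3 / 2 / 2 ^ j ≤ 1 / 2 ^ j := by gcongr; linarith
  unfold hyperCos
  linarith

theorem hyperCos_sq_add_sqrt_sq (j : ℕ) : hyperCos j ^ 2 + √(1 - hyperCos j ^ 2) ^ 2 = 1 := by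
  rw [Real.sq_sqrt]
  · ring
  · have := hyperCos_lt_one j
    have := hyperCos_pos j
    nlinarith

theorem sqrt_one_sub_hyperCos_sq_pos (j : ℕ) : 0 < √(1 - hyperCos j ^ 2) := by
  have := hyperCos_lt_one j
  have := hyperCos_pos j
  exact Real.sqrt_pos.2 (by nlinarith)

/-- Decay of correlations along the scale `hyperCos`. -/
theorem gaussCorr_hyperCos_pow_le {h : E → ℝ} {M : ℝ} (hm : Measurable h) (hM : ∀ x, |h x| ≤ M)
    (hV : 0 < ∫ x, h x ^ 2 ∂stdGaussian E) (j : ℕ) :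
    (gaussCorr h (hyperCos j) √(1 - hyperCos j ^ 2) / ∫ x, h x ^ 2 ∂stdGaussian E) ^ (4 * 2 ^ j) ≤
      (∫ x, |h x| ∂stdGaussian E) ^ 2 / ∫ x, h x ^ 2 ∂stdGaussian E := by
  induction j with
  | zero =>
    have hk : √(1 / 2) ^ 2 + √(1 / 2) ^ 2 = (1 : ℝ) := by
      rw [Real.sq_sqrt (by norm_num)]; norm_num
    have hsk : √(1 - hyperCos 0 ^ 2) * √(1 / 2) = hyperCos 0 := by
      rw [← Real.sqrt_mul' _ (by norm_num), hyperCos_zero_sq,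
        show (1 - 1 / 3 : ℝ) * (1 / 2) = 1 / 3 by norm_num, ← hyperCos_zero_sq,
        Real.sqrt_sq (hyperCos_pos 0).le]
    have := gaussCorr_pow_le (hyperCos_sq_add_sqrt_sq 0) hk hsk hm hM
    rw [pow_zero, mul_one, div_pow, div_le_div_iff₀ (by positivity) hV]
    calc _ ≤ ((∫ x, |h x| ∂stdGaussian E) ^ 2 * (∫ x, h x ^ 2 ∂stdGaussian E) ^ 3) *
        ∫ x, h x ^ 2 ∂stdGaussian E := by gcongr
      _ = _ := by ring
  | succ j ih =>
    have h1 := gaussCorr_sq_le (hyperCos_sq_add_sqrt_sq (j + 1)) (sqrt_one_sub_hyperCos_sq_pos j)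
      (by rw [hyperCos_succ_sq]; exact hyperCos_sq_add_sqrt_sq j) hm hM
    rw [hyperCos_succ_sq] at h1
    rw [show 4 * 2 ^ (j + 1) = 2 * (4 * 2 ^ j) by ring, pow_mul]
    refine le_trans (pow_le_pow_left₀ (sq_nonneg _) ?_ _) ih
    rw [div_pow, div_le_div_iff₀ (by positivity) hV, hyperCos_succ_sq]
    nlinarith

/-- `L¹` Talagrand inequality for a function with linearly growing Gaussian increments. -/
theorem gaussVar_le_of_gaussIncr_le {g : E → ℝ} (hm : Measurable g) (hg : ∀ x, |g x| ≤ 1) {G : ℝ}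
    (hG : 0 < G)
    (h : ∀ α, 0 ≤ α → α ≤ Real.pi / 2 → gaussIncr g (Real.cos α) (Real.sin α) ≤ α * G) :
    gaussVar g ≤ 10000 * G / √(1 + max (Real.log (1 / G)) 0) := by
  set L := Real.log (1 / G) with hL
  have hV1 := gaussVar_le_one hm hg
  have hGL : G = Real.exp (-L) := by rw [hL, one_div, Real.log_inv, neg_neg, Real.exp_log hG]
  have hs0 : 0 < √(1 + max L 0) := Real.sqrt_pos.2 (by positivity)
  have he8 : Real.exp 8 ≤ 3000 := by
    have := Real.exp_one_lt_d9
    calc Real.exp 8 = Real.exp 1 ^ 8 := by rw [← Real.exp_nat_mul]; norm_num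
      _ ≤ 2.7182818286 ^ 8 := by gcongr
      _ ≤ _ := by norm_num
  have he8' : 2900 ≤ Real.exp 8 := by
    have := Real.exp_one_gt_d9
    calc (2900 : ℝ) ≤ 2.7182818283 ^ 8 := by norm_num
      _ ≤ Real.exp 1 ^ 8 := by gcongr
      _ = Real.exp 8 := by rw [← Real.exp_nat_mul]; norm_num
  rcases le_or_gt L 8 with hL8 | hL8
  · have h1 : √(1 + max L 0) ≤ 3 := by
      rw [Real.sqrt_le_left (by norm_num)]
      have : max L 0 ≤ 8 := max_le hL8 (by norm_num)
      linarith
    have h2 : 1 / 3000 ≤ G := by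
      rw [hGL]
      calc (1 / 3000 : ℝ) ≤ (Real.exp 8)⁻¹ := by
            rw [one_div]; exact inv_anti₀ (Real.exp_pos _) he8
        _ = Real.exp (-8) := (Real.exp_neg _).symm
        _ ≤ _ := Real.exp_le_exp.2 (by linarith)
    rw [le_div_iff₀ hs0]
    nlinarith
  have hmax : max L 0 = L := max_eq_left (by linarith)
  rw [hmax] at hs0 ⊢
  have hsq : √(1 + L) ^ 2 = 1 + L := Real.sq_sqrt (by linarith)
  by_cases hVG : gaussVar g ≤ G / √(1 + L)
  · refine hVG.trans ?_
    gcongr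
    linarith
  push Not at hVG
  have hV0 : 0 < gaussVar g := lt_trans (by positivity) hVG
  set q := fun x => g x - ∫ x, g x ∂stdGaussian E with hq
  have hqV : ∫ x, q x ^ 2 ∂stdGaussian E = gaussVar g := (gaussVar_eq hm hg).symm
  have hm1 : ∫ x, |q x| ∂stdGaussian E ≤ 2 * G := by
    have h1 := integral_abs_sub_mean_le hm hg
    have h2 := h (Real.pi / 2) (by positivity) le_rfl
    rw [Real.cos_pi_div_two, Real.sin_pi_div_two] at h2
    have := Real.pi_lt_four
    refine h1.trans (h2.trans ?_)
    gcongr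
    linarith
  have hm0 : 0 ≤ ∫ x, |q x| ∂stdGaussian E := integral_nonneg fun x => abs_nonneg _
  have hδ : (∫ x, |q x| ∂stdGaussian E) ^ 2 / gaussVar g ≤ Real.exp (-(L / 2)) := by
    rw [div_le_iff₀ hV0]
    set r := Real.exp (L / 2) with hr
    have hr0 : 0 < r := Real.exp_pos _
    have hrG : G * r ^ 2 = 1 := by
      rw [hGL, hr, ← Real.exp_nat_mul, ← Real.exp_add]
      simp only [Real.exp_eq_one_iff]
      push_cast
      ring
    have hr2 : r ^ 2 = Real.exp L := by rw [hr, ← Real.exp_nat_mul]; congr 1; push_cast; ring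
    have hLe : 16 * (1 + L) ≤ r ^ 2 := by
      rw [hr2, show L = 8 + (L - 8) by ring, Real.exp_add]
      have := Real.add_one_le_exp (L - 8)
      nlinarith
    have hsr : 4 * √(1 + L) ≤ r := by
      apply le_of_sq_le_sq _ hr0.le
      rw [mul_pow, hsq]
      linarith
    rw [div_lt_iff₀ hs0] at hVG
    rw [Real.exp_neg, ← hr]
    have a1 : (∫ x, |q x| ∂stdGaussian E) ^ 2 ≤ 4 * G ^ 2 := by nlinarith
    refine a1.trans ?_
    rw [inv_mul_eq_div, le_div_iff₀ hr0]
    have a2 : 4 * G ≤ gaussVar g * r := by nlinarith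
    have a3 : 4 * G ^ 2 * r * r ≤ gaussVar g * r := by
      calc 4 * G ^ 2 * r * r = 4 * G * (G * r ^ 2) := by ring
        _ = 4 * G := by rw [hrG, mul_one]
        _ ≤ _ := a2
    exact le_of_mul_le_mul_right a3 hr0
  obtain ⟨j, hj1, hj2⟩ := exists_two_pow_dyadic hL8.le
  have hpow := gaussCorr_hyperCos_pow_le (h := q) (M := 2) (by fun_prop)
    (abs_sub_mean_le_two hg) (by rw [hqV]; exact hV0) j
  rw [hqV] at hpow
  have hβ : gaussCorr q (hyperCos j) √(1 - hyperCos j ^ 2) / gaussVar g ≤ 1 / 2 := by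
    by_contra! hlt
    have h1 : (1 / 2 : ℝ) ^ (4 * 2 ^ j) < Real.exp (-(L / 2)) :=
      lt_of_lt_of_le (pow_lt_pow_left₀ hlt (by norm_num) (by positivity)) (hpow.trans hδ)
    have h2 : Real.exp (-(L / 2)) ≤ Real.exp (-1) ^ (4 * 2 ^ j) := by
      rw [← Real.exp_nat_mul]
      apply Real.exp_le_exp.2
      push_cast
      linarith
    have h3 : Real.exp (-1) ≤ 1 / 2 := by
      rw [Real.exp_neg, one_div]
      exact inv_anti₀ (by norm_num) (by have := Real.exp_one_gt_d9; linarith)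
    have h4 := pow_le_pow_left₀ (Real.exp_pos (-1)).le h3 (4 * 2 ^ j)
    linarith
  rw [div_le_iff₀ hV0] at hβ
  have hinc := gaussVar_sub_gaussCorr_le hm hg (hyperCos_sq_add_sqrt_sq j)
  rw [← hq] at hinc
  have hc1 := hyperCos_lt_one j
  have hc0 := hyperCos_pos j
  set α := Real.arccos (hyperCos j) with hα
  have hcosα : Real.cos α = hyperCos j := Real.cos_arccos (by linarith) hc1.le
  have hα0 : 0 ≤ α := Real.arccos_nonneg _
  have hαπ : α ≤ Real.pi / 2 := Real.arccos_le_pi_div_two.2 hc0.le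
  have hb := h α hα0 hαπ
  rw [hcosα, hα, Real.sin_arccos, ← hα] at hb
  have hα2 : α ^ 2 ≤ 160 / (1 + L) := by
    have h1 := Real.cos_le_one_sub_mul_cos_sq (x := α) (by
      rw [abs_of_nonneg hα0]; linarith [Real.pi_pos])
    rw [hcosα] at h1
    have h2 := one_sub_hyperCos_le j
    have hpi : Real.pi ^ 2 ≤ 10 := by
      have := Real.pi_lt_d2
      have := Real.pi_pos
      nlinarith
    have h3 : 2 / 10 * α ^ 2 ≤ 2 / Real.pi ^ 2 * α ^ 2 := by gcongr
    have h4 : α ^ 2 ≤ 5 / 2 ^ j := by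
      have : (5 : ℝ) / 2 ^ j = 5 * (1 / 2 ^ j) := by ring
      rw [this]; linarith
    refine h4.trans ?_
    rw [div_le_div_iff₀ (by positivity) (by linarith)]
    have : (1 : ℝ) ≤ 2 ^ j := one_le_pow₀ (by norm_num)
    linarith
  have hα3 : α * √(1 + L) ≤ 13 := by
    apply le_of_sq_le_sq _ (by norm_num)
    rw [mul_pow, hsq]
    rw [le_div_iff₀ (by linarith)] at hα2
    linarith
  rw [le_div_iff₀ hs0]
  have : gaussVar g ≤ 2 * (α * G) := by linarith
  calc gaussVar g * √(1 + L) ≤ 2 * (α * G) * √(1 + L) := by gcongr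
    _ = 2 * G * (α * √(1 + L)) := by ring
    _ ≤ 2 * G * 13 := by gcongr
    _ ≤ _ := by linarith

end Gaussian

section Polar
variable {E : Type*} [NormedAddCommGroup E] [InnerProductSpace ℝ E] [FiniteDimensional ℝ E]
  [MeasurableSpace E] [BorelSpace E]

/-- The standard Gaussian measure has a density proportional to `exp (-‖x‖ ^ 2 / 2)`. -/
theorem exists_stdGaussian_eq_withDensity : ∃ c : ℝ≥0∞, stdGaussian E =
    c • (volume : Measure E).withDensity fun x => ENNReal.ofReal (Real.exp (-(‖x‖ ^ 2 / 2))) := by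
  set ν := (volume : Measure E).withDensity fun x => ENNReal.ofReal (Real.exp (-(‖x‖ ^ 2 / 2)))
    with hν
  have hmeas : Measurable fun x : E => ENNReal.ofReal (Real.exp (-(‖x‖ ^ 2 / 2))) := by fun_prop
  have hint : Integrable (fun x : E => Real.exp (-(‖x‖ ^ 2 / 2))) := by
    have := (GaussianFourier.integrable_cexp_neg_mul_sq_norm_add (b := (1 / 2 : ℂ)) (by norm_num)
      0 (0 : E)).re
    refine this.congr (Filter.Eventually.of_forall fun x => ?_)
    have e : (-(1 / 2 : ℂ) * (‖x‖ : ℂ) ^ 2 + 0 * ((inner ℝ (0 : E) x : ℝ) : ℂ)) =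
      ((-(‖x‖ ^ 2 / 2) : ℝ) : ℂ) := by push_cast; ring
    simp only [e, ← Complex.ofReal_exp]
    exact Complex.ofReal_re _
  have hfin : IsFiniteMeasure ν := by
    rw [hν]; exact isFiniteMeasure_withDensity_ofReal hint.2
  set K : ℂ := (Real.pi / (1 / 2 : ℂ)) ^ (Module.finrank ℝ E / 2 : ℂ) with hK
  have hchar : ∀ t : E, charFun ν t = K * Complex.exp (-‖t‖ ^ 2 / 2) := by
    intro t
    have h := GaussianFourier.integral_cexp_neg_mul_sq_norm_add (b := (1 / 2 : ℂ)) (by norm_num)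
      Complex.I t
    rw [charFun_apply, hν, integral_withDensity_eq_integral_toReal_smul hmeas
      (Filter.Eventually.of_forall fun _ => ENNReal.ofReal_lt_top)]
    have e2 : Complex.exp (Complex.I ^ 2 * ‖t‖ ^ 2 / (4 * (1 / 2))) =
        Complex.exp (-‖t‖ ^ 2 / 2) := by
      congr 1
      rw [Complex.I_sq]
      ring
    rw [hK, ← e2, ← h]
    refine integral_congr_ae (Filter.Eventually.of_forall fun x => ?_)
    simp only
    rw [ENNReal.toReal_ofReal (Real.exp_pos _).le, Complex.real_smul, Complex.ofReal_exp,
      ← Complex.exp_add, real_inner_comm]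
    congr 1
    push_cast
    ring
  have hKν : K = ((ν Set.univ).toReal : ℂ) := by
    have := hchar 0
    simpa [charFun_zero, Measure.real] using this.symm
  have hK0 : K ≠ 0 := by
    rw [hK, Complex.cpow_def_of_ne_zero]
    · exact Complex.exp_ne_zero _
    · have : (Real.pi : ℂ) ≠ 0 := by exact_mod_cast Real.pi_ne_zero
      simp [this]
  have hν0 : ν Set.univ ≠ 0 := by
    intro h0
    rw [h0] at hKν
    exact hK0 (by simpa using hKν)
  refine ⟨(ν Set.univ)⁻¹, ?_⟩
  have hfin2 : IsFiniteMeasure ((ν Set.univ)⁻¹ • ν) := Measure.smul_finite _ (by simpa using hν0)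
  apply Measure.ext_of_charFun
  ext t
  rw [charFun_stdGaussian, charFun_apply, integral_smul_measure, ← charFun_apply, hchar,
    ENNReal.toReal_inv, hKν]
  rw [hKν] at hK0
  rw [Complex.real_smul]
  push_cast
  field_simp

theorem lintegral_volume_polar [Nontrivial E] {f : E → ℝ≥0∞} (hf : Measurable f) :
    ∫⁻ x, f x = ∫⁻ θ, ∫⁻ r in Set.Ioi (0 : ℝ), ENNReal.ofReal (r ^ (Module.finrank ℝ E - 1)) *
      f (r • (θ : E)) ∂(volume : Measure ℝ) ∂(volume : Measure E).toSphere := by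
  set d := Module.finrank ℝ E with hd
  calc ∫⁻ x, f x = ∫⁻ x : ({(0)}ᶜ : Set E), f x ∂((volume : Measure E).comap (↑)) := by
        rw [lintegral_subtype_comap (measurableSet_singleton _).compl,
          restrict_compl_singleton]
    _ = ∫⁻ p, f ((p.2 : ℝ) • (p.1 : E)) ∂(volume : Measure E).toSphere.prod
          (.volumeIoiPow (d - 1)) := by
        rw [← ((volume : Measure E).measurePreserving_homeomorphUnitSphereProd).lintegral_comp_emb
          (Homeomorph.measurableEmbedding _)]
        refine lintegral_congr fun x => ?_
        have hx : ‖(x : E)‖ ≠ 0 := norm_ne_zero_iff.2 x.2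
        simp [smul_smul, hx]
    _ = _ := by
        rw [lintegral_prod (fun p : Metric.sphere (0 : E) 1 × Set.Ioi (0 : ℝ) =>
          f ((p.2 : ℝ) • (p.1 : E))) (by fun_prop)]
        refine lintegral_congr fun θ => ?_
        rw [Measure.volumeIoiPow, lintegral_withDensity_eq_lintegral_mul _ (by fun_prop)
          (by fun_prop)]
        exact lintegral_subtype_comap measurableSet_Ioi
          fun r => ENNReal.ofReal (r ^ (d - 1)) * f (r • (θ : E))

end Polar

theorem Gamma_ratio_le {n : ℕ} (hn : 2 ≤ n) :
    Real.Gamma (((n : ℝ) - 1) / 2) / Real.Gamma ((n : ℝ) / 2) ≤ 2 * √2 / √n := by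
  have hn' : (2 : ℝ) ≤ n := by exact_mod_cast hn
  have h0 : 0 < Real.Gamma (((n : ℝ) - 1) / 2) := Real.Gamma_pos_of_pos (by linarith)
  have h1 : 0 < Real.Gamma ((n : ℝ) / 2) := Real.Gamma_pos_of_pos (by linarith)
  have hc := Real.Gamma_mul_add_mul_le_rpow_Gamma_mul_rpow_Gamma (s := (n : ℝ) / 2)
    (t := (n : ℝ) / 2 + 1) (a := 1 / 2) (b := 1 / 2) (by linarith) (by linarith) (by norm_num)
    (by norm_num) (by norm_num)
  rw [Real.Gamma_add_one (by linarith),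
    show 1 / 2 * ((n : ℝ) / 2) + 1 / 2 * (n / 2 + 1) = ((n : ℝ) - 1) / 2 + 1 by ring,
    Real.Gamma_add_one (by linarith), ← Real.sqrt_eq_rpow, ← Real.sqrt_eq_rpow,
    ← Real.sqrt_mul h1.le, show Real.Gamma ((n : ℝ) / 2) * (n / 2 * Real.Gamma (n / 2)) =
      (n / 2) * Real.Gamma (n / 2) ^ 2 by ring, Real.sqrt_mul (by linarith),
    Real.sqrt_sq h1.le, Real.sqrt_div (by linarith)] at hc
  have hs : √(n : ℝ) ^ 2 = n := Real.sq_sqrt (by linarith)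
  have h2 : √(2 : ℝ) ^ 2 = 2 := Real.sq_sqrt (by norm_num)
  have hsp : 0 < √(n : ℝ) := Real.sqrt_pos.2 (by linarith)
  have h2p : 0 < √(2 : ℝ) := Real.sqrt_pos.2 (by norm_num)
  rw [div_le_div_iff₀ h1 hsp]
  rw [div_mul_eq_mul_div √(n : ℝ), le_div_iff₀ h2p] at hc
  set A := Real.Gamma (((n : ℝ) - 1) / 2)
  set B := Real.Gamma ((n : ℝ) / 2)
  have h3 : (n : ℝ) / 4 * A ≤ ((n : ℝ) - 1) / 2 * A :=
    mul_le_mul_of_nonneg_right (by linarith) h0.le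
  have h4 : (n : ℝ) / 4 * A * √2 ≤ √n * B := (mul_le_mul_of_nonneg_right h3 h2p.le).trans hc
  have h5 : √(n : ℝ) * (√n * A * √2) ≤ √n * (4 * B) := by
    calc √(n : ℝ) * (√n * A * √2) = √n ^ 2 * A * √2 := by ring
      _ = 4 * (n / 4 * A * √2) := by rw [hs]; ring
      _ ≤ 4 * (√n * B) := by gcongr
      _ = _ := by ring
  have h6 := le_of_mul_le_mul_left h5 hsp
  have h7 : √2 * (A * √n) ≤ √2 * (2 * √2 * B) := by
    calc √2 * (A * √n) = √n * A * √2 := by ring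
      _ ≤ 4 * B := h6
      _ = 2 * √2 ^ 2 * B := by rw [h2]; ring
      _ = _ := by ring
  exact le_of_mul_le_mul_left h7 h2p

theorem lintegral_pow_mul_exp (k : ℕ) :
    ∫⁻ r in Set.Ioi (0 : ℝ), ENNReal.ofReal (r ^ k * Real.exp (-(r ^ 2 / 2))) =
      ENNReal.ofReal ((1 / 2 : ℝ) ^ (-((k : ℝ) + 1) / 2) * (1 / 2) *
        Real.Gamma (((k : ℝ) + 1) / 2)) := by
  have hk : (-1 : ℝ) < k := by linarith [Nat.cast_nonneg (α := ℝ) k]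
  rw [← integral_rpow_mul_exp_neg_mul_rpow (p := 2) (by norm_num) hk
    (by norm_num : (0 : ℝ) < 1 / 2)]
  have hi := integrableOn_rpow_mul_exp_neg_mul_rpow (p := 2) (s := k) hk (by norm_num)
    (by norm_num : (0 : ℝ) < 1 / 2)
  rw [ofReal_integral_eq_lintegral_ofReal hi]
  · refine setLIntegral_congr_fun measurableSet_Ioi fun r hr => ?_
    simp only [Real.rpow_natCast, Real.rpow_ofNat]
    congr 3
    ring
  · refine (ae_restrict_iff' measurableSet_Ioi).2 (Filter.Eventually.of_forall fun r hr => ?_)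
    have : 0 < r := hr
    simp only [Pi.zero_apply]
    positivity


theorem exists_lintegral_stdGaussian_polar {n : ℕ} (hn : 2 ≤ n) :
    ∃ c : ℝ≥0∞, ∀ φ : ℝ → ℝ≥0∞, ∀ Ψ : EuclideanSpace ℝ (Fin n) → ℝ≥0∞, Measurable φ →
      Measurable Ψ → ∫⁻ x, φ ‖x‖ * Ψ (‖x‖⁻¹ • x) ∂stdGaussian (EuclideanSpace ℝ (Fin n)) =
        c * (∫⁻ θ, Ψ θ ∂(volume : Measure (EuclideanSpace ℝ (Fin n))).toSphere) *
          ∫⁻ r in Set.Ioi (0 : ℝ), φ r *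
            ENNReal.ofReal (r ^ (n - 1) * Real.exp (-(r ^ 2 / 2))) := by
  have : Nonempty (Fin n) := ⟨⟨0, by omega⟩⟩
  obtain ⟨c, hc⟩ := exists_stdGaussian_eq_withDensity (E := EuclideanSpace ℝ (Fin n))
  refine ⟨c, fun φ Ψ hφ hΨ => ?_⟩
  rw [hc, lintegral_smul_measure, lintegral_withDensity_eq_lintegral_mul _ (by fun_prop)
    (by fun_prop), smul_eq_mul, mul_assoc]
  congr 1
  simp only [Pi.mul_apply]
  rw [lintegral_volume_polar (by fun_prop), ← lintegral_mul_const _ (by fun_prop)]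
  refine lintegral_congr fun θ => ?_
  rw [← lintegral_const_mul _ (by fun_prop)]
  refine setLIntegral_congr_fun measurableSet_Ioi fun r hr => ?_
  have hr0 : 0 < r := hr
  have hθ : ‖(θ : EuclideanSpace ℝ (Fin n))‖ = 1 := by simp
  simp only [norm_smul, hθ, mul_one, Real.norm_eq_abs, abs_of_pos hr0, smul_smul,
    inv_mul_cancel₀ hr0.ne', one_smul, finrank_euclideanSpace, Fintype.card_fin]
  rw [ENNReal.ofReal_mul (by positivity)]
  ring

theorem toSphere_univ_ne_zero {n : ℕ} (hn : 2 ≤ n) :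
    (volume : Measure (EuclideanSpace ℝ (Fin n))).toSphere Set.univ ≠ 0 := by
  have : Nonempty (Fin n) := ⟨⟨0, by omega⟩⟩
  rw [Measure.measure_univ_ne_zero]
  exact Measure.toSphere_ne_zero _

theorem isProbabilityMeasure_sphereUniform {n : ℕ} (hn : 2 ≤ n) :
    IsProbabilityMeasure (sphereUniform n) :=
  ⟨by
    rw [sphereUniform, Measure.smul_apply, smul_eq_mul]
    exact ENNReal.inv_mul_cancel (toSphere_univ_ne_zero hn) (measure_ne_top _ _)⟩

/-- The norm and the direction of a standard Gaussian vector are independent. -/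
theorem lintegral_stdGaussian_polar {n : ℕ} (hn : 2 ≤ n) {φ : ℝ → ℝ≥0∞}
    {Ψ : EuclideanSpace ℝ (Fin n) → ℝ≥0∞} (hφ : Measurable φ) (hΨ : Measurable Ψ) :
    ∫⁻ x, φ ‖x‖ * Ψ (‖x‖⁻¹ • x) ∂stdGaussian (EuclideanSpace ℝ (Fin n)) =
      (∫⁻ x, φ ‖x‖ ∂stdGaussian (EuclideanSpace ℝ (Fin n))) * ∫⁻ θ, Ψ θ ∂sphereUniform n := by
  obtain ⟨c, hc⟩ := exists_lintegral_stdGaussian_polar hn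
  have h1 := hc φ 1 hφ measurable_one
  simp only [Pi.one_apply, mul_one, lintegral_one] at h1
  rw [hc φ Ψ hφ hΨ, h1, sphereUniform, lintegral_smul_measure, smul_eq_mul]
  set σ := (volume : Measure (EuclideanSpace ℝ (Fin n))).toSphere
  set I := ∫⁻ r in Set.Ioi (0 : ℝ), φ r *
            ENNReal.ofReal (r ^ (n - 1) * Real.exp (-(r ^ 2 / 2)))
  calc c * (∫⁻ θ, Ψ θ ∂σ) * I = c * (σ Set.univ * (σ Set.univ)⁻¹ * ∫⁻ θ, Ψ θ ∂σ) * I := by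
        rw [ENNReal.mul_inv_cancel (toSphere_univ_ne_zero hn) (measure_ne_top _ _), one_mul]
    _ = _ := by ring

theorem lintegral_stdGaussian_direction {n : ℕ} (hn : 2 ≤ n)
    {Ψ : EuclideanSpace ℝ (Fin n) → ℝ≥0∞} (hΨ : Measurable Ψ) :
    ∫⁻ x, Ψ (‖x‖⁻¹ • x) ∂stdGaussian (EuclideanSpace ℝ (Fin n)) =
      ∫⁻ θ, Ψ θ ∂sphereUniform n := by
  have := lintegral_stdGaussian_polar hn (φ := 1) measurable_one hΨ
  simpa using this

theorem lintegral_inv_norm_stdGaussian_le {n : ℕ} (hn : 2 ≤ n) :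
    ∫⁻ x, ENNReal.ofReal ‖x‖⁻¹ ∂stdGaussian (EuclideanSpace ℝ (Fin n)) ≤
      ENNReal.ofReal (2 / √n) := by
  obtain ⟨c, hc⟩ := exists_lintegral_stdGaussian_polar hn
  have h1 := hc 1 1 measurable_one measurable_one
  have h2 := hc (fun r => ENNReal.ofReal r⁻¹) 1 (by fun_prop) measurable_one
  simp only [Pi.one_apply, mul_one, lintegral_one, one_mul, measure_univ] at h1 h2
  set σ := (volume : Measure (EuclideanSpace ℝ (Fin n))).toSphere
  have e : ∫⁻ r in Set.Ioi (0 : ℝ), ENNReal.ofReal r⁻¹ *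
      ENNReal.ofReal (r ^ (n - 1) * Real.exp (-(r ^ 2 / 2))) =
      ∫⁻ r in Set.Ioi (0 : ℝ), ENNReal.ofReal (r ^ (n - 2) * Real.exp (-(r ^ 2 / 2))) := by
    refine setLIntegral_congr_fun measurableSet_Ioi fun r hr => ?_
    have hr0 : 0 < r := hr
    rw [← ENNReal.ofReal_mul (by positivity), show n - 1 = n - 2 + 1 by omega, pow_succ]
    congr 1
    field_simp
  rw [e, lintegral_pow_mul_exp] at h2
  rw [lintegral_pow_mul_exp] at h1
  rw [h2]
  have hn' : (2 : ℝ) ≤ n := by exact_mod_cast hn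
  have c1 : ((n - 1 : ℕ) : ℝ) + 1 = n := by
    rw [Nat.cast_sub (by omega)]; push_cast; ring
  have c2 : ((n - 2 : ℕ) : ℝ) + 1 = n - 1 := by
    rw [Nat.cast_sub (by omega)]; push_cast; ring
  rw [c1] at h1
  rw [c2]
  have g1 : 0 < Real.Gamma ((n : ℝ) / 2) := Real.Gamma_pos_of_pos (by linarith)
  have hsn : 0 < √(n : ℝ) := Real.sqrt_pos.2 (by linarith)
  have key : (1 / 2 : ℝ) ^ (-((n : ℝ) - 1) / 2) * (1 / 2) * Real.Gamma (((n : ℝ) - 1) / 2) ≤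
      2 / √n * ((1 / 2 : ℝ) ^ (-(n : ℝ) / 2) * (1 / 2) * Real.Gamma ((n : ℝ) / 2)) := by
    have hr := Gamma_ratio_le hn
    rw [div_le_iff₀ g1] at hr
    have hp : (1 / 2 : ℝ) ^ (-((n : ℝ) - 1) / 2) = (1 / 2 : ℝ) ^ (-(n : ℝ) / 2) * (1 / √2) := by
      rw [show -((n : ℝ) - 1) / 2 = -(n : ℝ) / 2 + 1 / 2 by ring, Real.rpow_add (by norm_num),
        ← Real.sqrt_eq_rpow, Real.sqrt_div (by norm_num), Real.sqrt_one]
    have h2p : 0 < √(2 : ℝ) := Real.sqrt_pos.2 (by norm_num)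
    rw [hp]
    have hP : 0 < (1 / 2 : ℝ) ^ (-(n : ℝ) / 2) := by positivity
    set P := (1 / 2 : ℝ) ^ (-(n : ℝ) / 2)
    calc P * (1 / √2) * (1 / 2) * Real.Gamma (((n : ℝ) - 1) / 2) ≤
        P * (1 / √2) * (1 / 2) * (2 * √2 / √n * Real.Gamma ((n : ℝ) / 2)) := by gcongr
      _ = _ := by field_simp
  calc c * σ Set.univ * ENNReal.ofReal _ ≤ c * σ Set.univ * ENNReal.ofReal _ := by
        refine mul_le_mul' le_rfl (ENNReal.ofReal_le_ofReal key)
    _ = _ := by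
      rw [ENNReal.ofReal_mul (by positivity), ← mul_assoc, mul_comm (c * σ Set.univ), mul_assoc,
        ← h1, mul_one]

section Paths
variable {E : Type*} [NormedAddCommGroup E] [InnerProductSpace ℝ E] [FiniteDimensional ℝ E]
  [MeasurableSpace E] [BorelSpace E]

theorem lintegral_enorm_dual_stdGaussian_le (L : E →L[ℝ] ℝ) :
    ∫⁻ y, ‖L y‖ₑ ∂stdGaussian E ≤ ‖L‖ₑ := by
  have h1 := lintegral_mul_sq_le (stdGaussian E) (f := fun _ => 1) (g := fun y => ‖L y‖ₑ)
    (by fun_prop) (by fun_prop)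
  have h2 : ∫⁻ y, ‖L y‖ₑ ^ 2 ∂stdGaussian E = ‖L‖ₑ ^ 2 := by
    have hv := (IsGaussian.memLp_dual (stdGaussian E) L 2 (by simp)).ofReal_variance_eq
    rw [variance_dual_stdGaussian, evariance, integral_strongDual_stdGaussian] at hv
    simp only [sub_zero] at hv
    rw [← hv, ENNReal.ofReal_pow (norm_nonneg _), ofReal_norm]
  simp only [one_mul, one_pow, lintegral_one, measure_univ] at h1
  rw [h2] at h1
  exact (ENNReal.pow_le_pow_left_iff two_ne_zero).1 h1

theorem stdGaussian_absolutelyContinuous : stdGaussian E ≪ (volume : Measure E) := by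
  obtain ⟨c, hc⟩ := exists_stdGaussian_eq_withDensity (E := E)
  rw [hc]
  exact (withDensity_absolutelyContinuous _ _).smul_left c

theorem stdGaussian_submodule {s : Submodule ℝ E} (hs : s ≠ ⊤) : stdGaussian E s = 0 :=
  stdGaussian_absolutelyContinuous (Measure.addHaar_submodule _ s hs)

theorem ae_cos_smul_add_sin_smul_ne_zero (hE : 2 ≤ Module.finrank ℝ E) :
    ∀ᵐ p ∂(stdGaussian E).prod (stdGaussian E), ∀ u : ℝ,
      Real.cos u • p.1 + Real.sin u • p.2 ≠ 0 := by
  have hmeas : MeasurableSet {p : E × E | ‖p.1‖ ^ 2 • p.2 = inner ℝ p.1 p.2 • p.1} :=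
    (isClosed_eq (by fun_prop) (by fun_prop)).measurableSet
  have hspan : ∀ x : E, Submodule.span ℝ {x} ≠ ⊤ := fun x h => by
    have h1 := finrank_span_le_card (R := ℝ) ({x} : Set E)
    rw [h, finrank_top, Set.toFinset_singleton, Finset.card_singleton] at h1
    omega
  have hnull : (stdGaussian E).prod (stdGaussian E)
      {p : E × E | ‖p.1‖ ^ 2 • p.2 = inner ℝ p.1 p.2 • p.1} = 0 := by
    rw [Measure.measure_prod_null hmeas]
    have h0 : ∀ᵐ x ∂stdGaussian E, x ≠ 0 := by
      have := stdGaussian_submodule (hspan (0 : E))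
      rw [ae_iff]
      refine measure_mono_null (fun x hx => ?_) this
      simpa using hx
    filter_upwards [h0] with x hx
    refine measure_mono_null (fun y hy => ?_) (stdGaussian_submodule (hspan x))
    have hy' : ‖x‖ ^ 2 • y = inner ℝ x y • x := hy
    have hx2 : ‖x‖ ^ 2 ≠ 0 := by simpa using hx
    refine Submodule.mem_span_singleton.2 ⟨(‖x‖ ^ 2)⁻¹ * inner ℝ x y, ?_⟩
    rw [mul_smul, ← hy', smul_smul, inv_mul_cancel₀ hx2, one_smul]
  rw [ae_iff]
  refine measure_mono_null (fun p hp => ?_) hnull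
  simp only [not_forall, not_not, Set.mem_ofPred_eq] at hp ⊢
  obtain ⟨u, hu⟩ := hp
  by_cases hs : Real.sin u = 0
  · have hc : Real.cos u ≠ 0 := fun h => by
      have := Real.sin_sq_add_cos_sq u
      rw [hs, h] at this
      norm_num at this
    have : p.1 = 0 := by simpa [hs, hc] using hu
    simp [this]
  · have : p.2 = (-(Real.sin u)⁻¹ * Real.cos u) • p.1 := by
      have h1 : p.2 = (Real.sin u)⁻¹ • (Real.sin u • p.2) := by
        rw [smul_smul, inv_mul_cancel₀ hs, one_smul]
      have h2 : Real.sin u • p.2 = -(Real.cos u • p.1) := eq_neg_of_add_eq_zero_right hu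
      rw [h1, h2]
      module
    rw [this, inner_smul_right, real_inner_self_eq_norm_sq]
    module

/-- Maurey–Pisier rotation bound for the `L¹` increments of a function that is smooth away
from the origin. -/
theorem lintegral_increment_le (hE : 2 ≤ Module.finrank ℝ E) {g : E → ℝ}
    (hg : ContDiffOn ℝ 1 g {0}ᶜ) {α : ℝ} (hα : 0 ≤ α) {A : Set E} (hA : MeasurableSet A)
    {S : Set (E × E)} (hS : MeasurableSet S)
    (hSA : ∀ p ∈ S, ∀ u ∈ Set.Icc 0 α, Real.cos u • p.1 + Real.sin u • p.2 ∈ A) :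
    ∫⁻ p in S, ‖g p.1 - g (Real.cos α • p.1 + Real.sin α • p.2)‖ₑ
        ∂(stdGaussian E).prod (stdGaussian E) ≤
      ENNReal.ofReal α * ∫⁻ x in A, ‖fderiv ℝ g x‖ₑ ∂stdGaussian E := by
  set γ := stdGaussian E with hγ
  set k : E × E → ℝ≥0∞ := fun p => A.indicator (fun _ => (1 : ℝ≥0∞)) p.1 * ‖fderiv ℝ g p.1 p.2‖ₑ
    with hk
  have hind : Measurable (A.indicator fun _ => (1 : ℝ≥0∞)) := measurable_const.indicator hA
  have hkm : Measurable k := by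
    refine (hind.comp measurable_fst).mul (Measurable.enorm ?_)
    have h1 : Measurable fun p : E × E => fderiv ℝ g p.1 :=
      (measurable_fderiv ℝ g).comp measurable_fst
    exact (isBoundedBilinearMap_apply (𝕜 := ℝ) (E := E) (F := ℝ)).continuous.measurable.comp
      (h1.prodMk measurable_snd)
  have hpt : ∀ᵐ p ∂γ.prod γ, S.indicator (fun p : E × E =>
      ‖g p.1 - g (Real.cos α • p.1 + Real.sin α • p.2)‖ₑ) p ≤
      ∫⁻ u in Set.Icc 0 α, k (rot (Real.cos u) (Real.sin u) p) := by
    filter_upwards [ae_cos_smul_add_sin_smul_ne_zero hE] with p hp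
    by_cases hpS : p ∈ S
    swap
    · simp [hpS]
    rw [Set.indicator_of_mem hpS]
    set c : ℝ → E := fun u => Real.cos u • p.1 + Real.sin u • p.2 with hc
    have hcd : ContDiff ℝ 1 c := by fun_prop
    have hder : ∀ u, HasDerivAt c (-Real.sin u • p.1 + Real.cos u • p.2) u := fun u =>
      ((Real.hasDerivAt_cos u).smul_const _).add ((Real.hasDerivAt_sin u).smul_const _)
    have hgc : ContDiffOn ℝ 1 (g ∘ c) (Set.Icc 0 α) :=
      hg.comp hcd.contDiffOn fun u _ => hp u
    have h1 := enorm_sub_le_lintegral_deriv_of_contDiffOn_Icc hgc hα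
    have h0 : c 0 = p.1 := by simp [hc]
    rw [Function.comp_apply, Function.comp_apply, h0, ← enorm_neg, neg_sub] at h1
    refine h1.trans (setLIntegral_mono' measurableSet_Icc fun u hu => ?_)
    have hdg : DifferentiableAt ℝ g (c u) :=
      (hg.contDiffAt (isOpen_compl_singleton.mem_nhds (hp u))).differentiableAt one_ne_zero
    rw [(hdg.hasFDerivAt.comp_hasDerivAt u (hder u)).deriv]
    simp only [hk, rot]
    rw [Set.indicator_of_mem (hSA p hpS u hu), one_mul]
  calc ∫⁻ p in S, ‖g p.1 - g (Real.cos α • p.1 + Real.sin α • p.2)‖ₑ ∂γ.prod γ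
      ≤ ∫⁻ p, (∫⁻ u in Set.Icc 0 α, k (rot (Real.cos u) (Real.sin u) p)) ∂γ.prod γ := by
        rw [← lintegral_indicator hS]
        exact lintegral_mono_ae hpt
    _ = ∫⁻ u in Set.Icc 0 α, (∫⁻ p, k (rot (Real.cos u) (Real.sin u) p) ∂γ.prod γ) := by
        refine lintegral_lintegral_swap (Measurable.aemeasurable ?_)
        refine hkm.comp ?_
        unfold rot
        fun_prop
    _ = ∫⁻ _u in Set.Icc 0 α, (∫⁻ p, k p ∂γ.prod γ) := by
        refine lintegral_congr fun u => ?_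
        exact (measurePreserving_rot (Real.cos_sq_add_sin_sq u)).lintegral_comp hkm
    _ = ENNReal.ofReal α * ∫⁻ p, k p ∂γ.prod γ := by
        rw [setLIntegral_const, Real.volume_Icc, sub_zero, mul_comm]
    _ ≤ _ := by
        refine mul_le_mul' le_rfl ?_
        rw [lintegral_prod _ hkm.aemeasurable, ← lintegral_indicator hA]
        refine lintegral_mono fun x => ?_
        simp only [hk]
        rw [lintegral_const_mul _ (by fun_prop)]
        refine (mul_le_mul' le_rfl (lintegral_enorm_dual_stdGaussian_le _)).trans ?_
        by_cases hx : x ∈ A <;> simp [hx]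

end Paths

section Radial

/-- The extension of `F` from the unit sphere that is constant along rays. -/
noncomputable def radialExt {E : Type*} [NormedAddCommGroup E] [NormedSpace ℝ E] (F : E → ℝ)
    (x : E) : ℝ :=
  Set.indicator {0}ᶜ (fun x => F (‖x‖⁻¹ • x)) x

section
variable {E : Type*} [NormedAddCommGroup E] [InnerProductSpace ℝ E]

theorem norm_inv_norm_smul {x : E} (hx : x ≠ 0) : ‖(‖x‖⁻¹ • x)‖ = 1 := by
  rw [norm_smul, norm_inv, norm_norm, inv_mul_cancel₀ (norm_ne_zero_iff.2 hx)]

theorem hasFDerivAt_inv_norm {x : E} (hx : x ≠ 0) :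
    HasFDerivAt (fun x : E => ‖x‖⁻¹) (-(‖x‖ ^ 3)⁻¹ • innerSL ℝ x) x := by
  have hx' : ‖x‖ ≠ 0 := norm_ne_zero_iff.2 hx
  have h0 := (hasStrictFDerivAt_norm_sq x).hasFDerivAt.sqrt (by positivity)
  simp only [Real.sqrt_sq (norm_nonneg _)] at h0
  have h1 := (hasDerivAt_inv hx').comp_hasFDerivAt x h0
  refine h1.congr_fderiv ?_
  rw [smul_smul, ← Nat.cast_smul_eq_nsmul ℝ 2, smul_smul]
  congr 1
  push_cast
  field_simp

theorem hasFDerivAt_radialExt {F : E → ℝ} (hF : Differentiable ℝ F) {x : E} (hx : x ≠ 0) :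
    HasFDerivAt (radialExt F) ((fderiv ℝ F (‖x‖⁻¹ • x)).comp
      (‖x‖⁻¹ • ContinuousLinearMap.id ℝ E + (-(‖x‖ ^ 3)⁻¹ • innerSL ℝ x).smulRight x)) x := by
  have h1 : HasFDerivAt (fun x => F (‖x‖⁻¹ • x)) ((fderiv ℝ F (‖x‖⁻¹ • x)).comp
      (‖x‖⁻¹ • ContinuousLinearMap.id ℝ E + (-(‖x‖ ^ 3)⁻¹ • innerSL ℝ x).smulRight x)) x :=
    (hF _).hasFDerivAt.comp x ((hasFDerivAt_inv_norm hx).smul (hasFDerivAt_id x))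
  refine h1.congr_of_eventuallyEq ?_
  filter_upwards [isOpen_compl_singleton.mem_nhds hx] with y hy
  exact Set.indicator_of_mem hy _

theorem contDiffOn_radialExt {F : E → ℝ} (hF : ContDiff ℝ 1 F) :
    ContDiffOn ℝ 1 (radialExt F) {0}ᶜ := by
  have h : ContDiffOn ℝ 1 (fun x : E => F (‖x‖⁻¹ • x)) {0}ᶜ := by
    refine hF.comp_contDiffOn (ContDiffOn.smul ?_ contDiffOn_id)
    exact (contDiffOn_id.norm ℝ fun x hx => hx).inv fun x hx => norm_ne_zero_iff.2 hx
  exact h.congr fun x hx => Set.indicator_of_mem hx _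

theorem abs_radialExt_le {F : E → ℝ} (hF : ∀ x ∈ Metric.sphere (0 : E) 1, |F x| ≤ 1) (x : E) :
    |radialExt F x| ≤ 1 := by
  by_cases hx : x = 0
  · simp [radialExt, hx]
  · rw [radialExt, Set.indicator_of_mem (by simpa using hx)]
    exact hF _ (by simpa using norm_inv_norm_smul hx)

theorem measurable_radialExt [MeasurableSpace E] [BorelSpace E] [SecondCountableTopology E]
    {F : E → ℝ} (hF : Continuous F) : Measurable (radialExt F) := by
  refine Measurable.indicator ?_ (measurableSet_singleton 0).compl
  exact hF.measurable.comp (measurable_norm.inv.smul measurable_id)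

end

variable {n : ℕ} {F : EuclideanSpace ℝ (Fin n) → ℝ} {x : EuclideanSpace ℝ (Fin n)}

/-- The sum of the absolute values of all angular derivatives. -/
noncomputable def angularSum (F : EuclideanSpace ℝ (Fin n) → ℝ) (x : EuclideanSpace ℝ (Fin n)) :
    ℝ :=
  ∑ i, ∑ j, |Dang n i j F x|

theorem Dang_direction_eq (hF : Differentiable ℝ F) (hx : x ≠ 0) (i j : Fin n) :
    Dang n i j F (‖x‖⁻¹ • x) =
      x i * fderiv ℝ (radialExt F) x (EuclideanSpace.single j 1) -
        x j * fderiv ℝ (radialExt F) x (EuclideanSpace.single i 1) := by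
  rw [(hasFDerivAt_radialExt hF hx).fderiv, Dang]
  simp [EuclideanSpace.inner_single_right]
  ring

theorem fderiv_radialExt_self (hF : Differentiable ℝ F) (hx : x ≠ 0) :
    fderiv ℝ (radialExt F) x x = 0 := by
  rw [(hasFDerivAt_radialExt hF hx).fderiv]
  have hx' : ‖x‖ ≠ 0 := norm_ne_zero_iff.2 hx
  simp only [ContinuousLinearMap.comp_apply, add_apply,
    smul_apply, ContinuousLinearMap.id_apply,
    ContinuousLinearMap.smulRight_apply, innerSL_apply_apply, real_inner_self_eq_norm_sq,
    smul_eq_mul, ← add_smul]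
  have : ‖x‖⁻¹ + -(‖x‖ ^ 3)⁻¹ * ‖x‖ ^ 2 = 0 := by field_simp; ring
  rw [this, zero_smul, map_zero]

theorem abs_coord_mul_norm_le {M : EuclideanSpace ℝ (Fin n) →L[ℝ] ℝ} (hx : x ≠ 0) (hM : M x = 0)
    (j : Fin n) (y : EuclideanSpace ℝ (Fin n)) :
    |x j| * |M y| ≤ (∑ i, |x i * M (EuclideanSpace.single j 1) -
      x j * M (EuclideanSpace.single i 1)|) * ‖y‖ := by
  have hx' : ‖x‖ ≠ 0 := norm_ne_zero_iff.2 hx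
  set z := y - (inner ℝ x y / ‖x‖ ^ 2) • x with hz
  have hxz : inner ℝ x z = 0 := by
    rw [hz, inner_sub_right, inner_smul_right, real_inner_self_eq_norm_sq]
    field_simp
    ring
  have hMz : M y = M z := by rw [hz, map_sub, map_smul, hM, smul_zero, sub_zero]
  have hzy : ‖z‖ ≤ ‖y‖ := by
    have h1 : y = z + (inner ℝ x y / ‖x‖ ^ 2) • x := by rw [hz]; abel
    have h2 := norm_add_sq_eq_norm_sq_add_norm_sq_of_inner_eq_zero z
      ((inner ℝ x y / ‖x‖ ^ 2) • x) (by rw [inner_smul_right, real_inner_comm x z, hxz, mul_zero])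
    rw [← h1] at h2
    nlinarith [norm_nonneg z, norm_nonneg y, norm_nonneg ((inner ℝ x y / ‖x‖ ^ 2) • x)]
  have hsum : z = ∑ i, z i • EuclideanSpace.single i (1 : ℝ) := by
    ext k
    simp [Pi.single_apply]
  have hin : ∑ i, z i * x i = 0 := by
    rw [← hxz, PiLp.inner_apply]
    simp
  have hkey : x j * M z = -∑ i, z i * (x i * M (EuclideanSpace.single j 1) -
      x j * M (EuclideanSpace.single i 1)) := by
    conv_lhs => rw [hsum, map_sum, Finset.mul_sum]
    have h0 : (∑ i, z i * x i) * M (EuclideanSpace.single j 1) = 0 := by rw [hin, zero_mul]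
    rw [Finset.sum_mul] at h0
    rw [← sub_zero (∑ i, x j * _), ← h0, ← Finset.sum_sub_distrib, ← Finset.sum_neg_distrib]
    refine Finset.sum_congr rfl fun i _ => ?_
    rw [map_smul, smul_eq_mul]
    ring
  rw [hMz, ← abs_mul, hkey, abs_neg, Finset.sum_mul]
  refine (Finset.abs_sum_le_sum_abs _ _).trans (Finset.sum_le_sum fun i _ => ?_)
  rw [abs_mul, mul_comm]
  refine mul_le_mul_of_nonneg_left ?_ (abs_nonneg _)
  exact (PiLp.norm_apply_le z i).trans hzy

theorem norm_le_sum_abs (x : EuclideanSpace ℝ (Fin n)) : ‖x‖ ≤ ∑ i, |x i| := by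
  rw [EuclideanSpace.norm_eq]
  refine Real.sqrt_le_iff.2 ⟨by positivity, ?_⟩
  exact Finset.sum_sq_le_sq_sum_of_nonneg fun i _ => norm_nonneg _

theorem sum_abs_mul_norm_fderiv_radialExt_le (hF : Differentiable ℝ F) (hx : x ≠ 0) :
    (∑ i, |x i|) * ‖fderiv ℝ (radialExt F) x‖ ≤ angularSum F (‖x‖⁻¹ • x) := by
  have hpos : 0 < ∑ i, |x i| := (norm_pos_iff.2 hx).trans_le (norm_le_sum_abs x)
  rw [← le_div_iff₀' hpos]
  refine ContinuousLinearMap.opNorm_le_bound _ (by unfold angularSum; positivity) fun y => ?_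
  rw [div_mul_eq_mul_div, le_div_iff₀' hpos, Finset.sum_mul, angularSum, Finset.sum_comm,
    Finset.sum_mul]
  refine Finset.sum_le_sum fun j _ => ?_
  simp only [Dang_direction_eq hF hx]
  exact abs_coord_mul_norm_le hx (fderiv_radialExt_self hF hx) j y

theorem continuous_Dang (hF : ContDiff ℝ 1 F) (i j : Fin n) : Continuous (Dang n i j F) := by
  have h := hF.continuous_fderiv one_ne_zero
  unfold Dang
  fun_prop

theorem continuous_angularSum (hF : ContDiff ℝ 1 F) : Continuous (angularSum F) := by
  have := continuous_Dang hF
  unfold angularSum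
  fun_prop

theorem sphNorm_one (g : EuclideanSpace ℝ (Fin n) → ℝ) :
    sphNorm n 1 g = ∫ x, |g (x : EuclideanSpace ℝ (Fin n))| ∂sphereUniform n := by
  simp [sphNorm]

theorem integrable_sphereUniform (hn : 2 ≤ n) {g : EuclideanSpace ℝ (Fin n) → ℝ}
    (hg : Continuous g) :
    Integrable (fun x : Metric.sphere (0 : EuclideanSpace ℝ (Fin n)) 1 => g x)
      (sphereUniform n) := by
  have := isProbabilityMeasure_sphereUniform hn
  exact (hg.comp continuous_subtype_val).integrable_of_hasCompactSupport
    (HasCompactSupport.of_compactSpace _)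

theorem lintegral_angularSum (hn : 2 ≤ n) (hF : ContDiff ℝ 1 F) :
    ∫⁻ θ, ENNReal.ofReal (angularSum F θ) ∂sphereUniform n =
      ENNReal.ofReal (∑ i, ∑ j, sphNorm n 1 (Dang n i j F)) := by
  have hi : ∀ i j, Integrable (fun x : Metric.sphere (0 : EuclideanSpace ℝ (Fin n)) 1 =>
      |Dang n i j F x|) (sphereUniform n) := fun i j =>
    (integrable_sphereUniform hn (continuous_Dang hF i j)).abs
  rw [← ofReal_integral_eq_lintegral_ofReal
    (integrable_sphereUniform hn (continuous_angularSum hF))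
    (Filter.Eventually.of_forall fun x => by unfold angularSum; positivity)]
  simp only [angularSum, sphNorm_one]
  rw [integral_finsetSum _ fun i _ => integrable_finsetSum _ fun j _ => hi i j]
  congr 2 with i
  rw [integral_finsetSum _ fun j _ => hi i j]

theorem ae_stdGaussian_ne_zero (hn : 2 ≤ n) :
    ∀ᵐ x ∂stdGaussian (EuclideanSpace ℝ (Fin n)), x ≠ 0 := by
  have : Nontrivial (EuclideanSpace ℝ (Fin n)) :=
    Module.nontrivial_of_finrank_pos (R := ℝ) (by simp; omega)
  have := stdGaussian_submodule (E := EuclideanSpace ℝ (Fin n)) bot_ne_top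
  rw [ae_iff]
  refine measure_mono_null (fun x hx => ?_) this
  simpa using hx

theorem lintegral_fderiv_radialExt_le (hn : 2 ≤ n) (hF : ContDiff ℝ 1 F) :
    ∫⁻ x, ‖fderiv ℝ (radialExt F) x‖ₑ ∂stdGaussian (EuclideanSpace ℝ (Fin n)) ≤
      ENNReal.ofReal (2 / √n * ∑ i, ∑ j, sphNorm n 1 (Dang n i j F)) := by
  rw [ENNReal.ofReal_mul (by positivity), ← lintegral_angularSum hn hF]
  refine le_trans ?_ (mul_le_mul_left (lintegral_inv_norm_stdGaussian_le hn) _)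
  rw [← lintegral_stdGaussian_polar hn (φ := fun r => ENNReal.ofReal r⁻¹)
    (Ψ := fun x => ENNReal.ofReal (angularSum F x)) (by fun_prop)
    (continuous_angularSum hF).measurable.ennreal_ofReal]
  refine lintegral_mono_ae ?_
  filter_upwards [ae_stdGaussian_ne_zero hn] with x hx
  rw [← ENNReal.ofReal_mul (by positivity), ← ofReal_norm]
  refine ENNReal.ofReal_le_ofReal ?_
  rw [inv_mul_eq_div, le_div_iff₀' (norm_pos_iff.2 hx)]
  refine le_trans ?_ (sum_abs_mul_norm_fderiv_radialExt_le (hF.differentiable one_ne_zero) hx)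
  exact mul_le_mul_of_nonneg_right (norm_le_sum_abs x) (norm_nonneg _)

theorem setLIntegral_fderiv_radialExt_le (hn : 2 ≤ n) (hF : ContDiff ℝ 1 F) {b : ℝ} (hb : 0 < b) :
    ∫⁻ x in {x | b ≤ ∑ i, |x i|}, ‖fderiv ℝ (radialExt F) x‖ₑ
        ∂stdGaussian (EuclideanSpace ℝ (Fin n)) ≤
      ENNReal.ofReal (b⁻¹ * ∑ i, ∑ j, sphNorm n 1 (Dang n i j F)) := by
  have hm := (continuous_angularSum hF).measurable.ennreal_ofReal
  rw [ENNReal.ofReal_mul (by positivity), ← lintegral_angularSum hn hF,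
    ← lintegral_stdGaussian_direction hn (Ψ := fun x => ENNReal.ofReal (angularSum F x)) hm,
    ← lintegral_const_mul' _ _ ENNReal.ofReal_ne_top]
  refine le_trans (lintegral_mono_ae ?_) (setLIntegral_le_lintegral _ _)
  have hA : MeasurableSet {x : EuclideanSpace ℝ (Fin n) | b ≤ ∑ i, |x i|} :=
    (isClosed_le (by fun_prop) (by fun_prop)).measurableSet
  filter_upwards [ae_restrict_mem hA] with x hx
  have hx0 : x ≠ 0 := by
    rintro rfl
    have : b ≤ 0 := by simpa using hx
    linarith
  rw [← ENNReal.ofReal_mul (by positivity), ← ofReal_norm]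
  refine ENNReal.ofReal_le_ofReal ?_
  rw [inv_mul_eq_div, le_div_iff₀' hb]
  refine le_trans ?_ (sum_abs_mul_norm_fderiv_radialExt_le (hF.differentiable one_ne_zero) hx0)
  exact mul_le_mul_of_nonneg_right hx (norm_nonneg _)

end Radial

theorem ofReal_gaussIncr {E : Type*} [NormedAddCommGroup E] [InnerProductSpace ℝ E]
    [FiniteDimensional ℝ E] [MeasurableSpace E] [BorelSpace E] {g : E → ℝ} (hm : Measurable g)
    (hg : ∀ x, |g x| ≤ 1) (c s : ℝ) :
    ENNReal.ofReal (gaussIncr g c s) = ∫⁻ p : E × E, ‖g p.1 - g (c • p.1 + s • p.2)‖ₑ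
      ∂(stdGaussian E).prod (stdGaussian E) := by
  have hi : Integrable (fun p : E × E => g p.1 - g (c • p.1 + s • p.2))
      ((stdGaussian E).prod (stdGaussian E)) :=
    integrable_of_abs_le (M := 2) (by fun_prop) fun p =>
      (abs_sub _ _).trans (by linarith [hg p.1, hg (c • p.1 + s • p.2)])
  exact ofReal_integral_norm_eq_lintegral_enorm hi

section Sphere
variable {n : ℕ} {F : EuclideanSpace ℝ (Fin n) → ℝ}

theorem integral_stdGaussian_direction (hn : 2 ≤ n) {Φ : EuclideanSpace ℝ (Fin n) → ℝ}
    (hΦ : Measurable Φ) :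
    ∫ x, Φ (‖x‖⁻¹ • x) ∂stdGaussian (EuclideanSpace ℝ (Fin n)) = ∫ θ, Φ θ ∂sphereUniform n := by
  have hd : Measurable fun x : EuclideanSpace ℝ (Fin n) => ‖x‖⁻¹ • x :=
    measurable_norm.inv.smul measurable_id
  have hmap : (stdGaussian (EuclideanSpace ℝ (Fin n))).map (fun x => ‖x‖⁻¹ • x) =
      (sphereUniform n).map Subtype.val := by
    ext s hs
    have := lintegral_stdGaussian_direction hn (Ψ := s.indicator 1) (measurable_one.indicator hs)
    rw [← lintegral_indicator_one hs, ← lintegral_indicator_one hs,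
      lintegral_map (measurable_one.indicator hs) hd,
      lintegral_map (measurable_one.indicator hs) measurable_subtype_coe]
    exact this
  rw [← integral_map hd.aemeasurable hΦ.aestronglyMeasurable, hmap,
    integral_map measurable_subtype_coe.aemeasurable hΦ.aestronglyMeasurable]

theorem sphVar_eq_gaussVar (hn : 2 ≤ n) (hF : Continuous F) :
    sphVar n F = gaussVar (radialExt F) := by
  have h : radialExt F =ᵐ[stdGaussian (EuclideanSpace ℝ (Fin n))] fun x => F (‖x‖⁻¹ • x) := by
    filter_upwards [ae_stdGaussian_ne_zero hn] with x hx
    exact Set.indicator_of_mem hx _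
  have h2 : (fun x => radialExt F x ^ 2) =ᵐ[stdGaussian (EuclideanSpace ℝ (Fin n))]
      fun x => F (‖x‖⁻¹ • x) ^ 2 := by
    filter_upwards [h] with x hx
    rw [hx]
  rw [sphVar, gaussVar, integral_congr_ae h, integral_congr_ae h2,
    integral_stdGaussian_direction hn hF.measurable,
    integral_stdGaussian_direction hn (Φ := fun x => F x ^ 2) (hF.pow 2).measurable]

theorem gaussIncr_radialExt_le (hn : 2 ≤ n) (hF : ContDiff ℝ 1 F)
    (hb : ∀ x ∈ Metric.sphere (0 : EuclideanSpace ℝ (Fin n)) 1, |F x| ≤ 1) {α : ℝ} (hα : 0 ≤ α) :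
    gaussIncr (radialExt F) (Real.cos α) (Real.sin α) ≤
      α * (2 / √n * ∑ i, ∑ j, sphNorm n 1 (Dang n i j F)) := by
  have hS : 0 ≤ ∑ i, ∑ j, sphNorm n 1 (Dang n i j F) := by
    simp only [sphNorm_one]
    positivity
  rw [← ENNReal.ofReal_le_ofReal_iff (by positivity),
    ofReal_gaussIncr (measurable_radialExt hF.continuous) (abs_radialExt_le hb),
    ENNReal.ofReal_mul hα, ← setLIntegral_univ]
  refine (lintegral_increment_le (A := Set.univ) (by simpa using hn) (contDiffOn_radialExt hF) hα
    MeasurableSet.univ MeasurableSet.univ fun _ _ _ _ => Set.mem_univ _).trans ?_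
  rw [setLIntegral_univ]
  exact mul_le_mul' le_rfl (lintegral_fderiv_radialExt_le hn hF)

/-- The mean of the absolute value of a standard normal variable. -/
noncomputable def gaussAbsMean : ℝ := ∫ z, |z| ∂gaussianReal 0 1

theorem gaussAbsMean_pos : 0 < gaussAbsMean := by
  have hi : Integrable (fun z : ℝ => |z|) (gaussianReal 0 1) :=
    ((memLp_id_gaussianReal (μ := 0) (v := 1) 1).integrable (by simp)).abs
  rw [gaussAbsMean, integral_pos_iff_support_of_nonneg (fun z => abs_nonneg z) hi]
  have : Function.support (fun z : ℝ => |z|) = {0}ᶜ := by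
    ext z
    simp
  have := nullSingletonClass_gaussianReal (μ := 0) (v := 1) one_ne_zero
  rw [‹Function.support _ = _›, prob_compl_eq_one_sub (measurableSet_singleton 0)]
  simp

theorem variance_abs_gaussianReal_le : variance (fun z : ℝ => |z|) (gaussianReal 0 1) ≤ 1 := by
  refine (variance_le_expectation_sq (by fun_prop)).trans ?_
  have h := variance_id_gaussianReal (μ := 0) (v := 1)
  rw [variance_eq_integral (by fun_prop)] at h
  simp only [id, integral_id_gaussianReal, sub_zero] at h
  simp [h]

theorem stdGaussian_sum_abs_deviation_le (hn : 1 ≤ n) :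
    stdGaussian (EuclideanSpace ℝ (Fin n))
      {x | n * gaussAbsMean / 2 ≤ |∑ i, |x i| - n * gaussAbsMean|} ≤
      ENNReal.ofReal (4 / (gaussAbsMean ^ 2 * n)) := by
  have hm := gaussAbsMean_pos
  have hn' : (0 : ℝ) < n := by exact_mod_cast hn
  have hX : MemLp (fun z : ℝ => |z|) 2 (gaussianReal 0 1) :=
    (memLp_id_gaussianReal (μ := 0) (v := 1) 2).abs
  set P := Measure.pi fun _ : Fin n => gaussianReal 0 1 with hP
  have hXi : ∀ i, MemLp (fun w : Fin n → ℝ => |w i|) 2 P := fun i =>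
    hX.comp_measurePreserving (measurePreserving_eval _ i)
  have hsum : MemLp (∑ i, fun w : Fin n → ℝ => |w i|) 2 P := memLp_finsetSum' _ fun i _ => hXi i
  have hmean : ∫ w, (∑ i, fun w : Fin n → ℝ => |w i|) w ∂P = n * gaussAbsMean := by
    simp only [Finset.sum_apply]
    rw [integral_finsetSum _ fun i _ => (hXi i).integrable (by norm_num)]
    have : ∀ i, ∫ w : Fin n → ℝ, |w i| ∂P = gaussAbsMean := fun i =>
      integral_comp_eval (μ := fun _ : Fin n => gaussianReal 0 1) (f := fun z : ℝ => |z|)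
        (by fun_prop)
    simp [this]
  have hvar : variance (∑ i, fun w : Fin n → ℝ => |w i|) P ≤ n := by
    rw [variance_sum_pi fun _ => hX]
    exact (Finset.sum_le_sum fun i _ => variance_abs_gaussianReal_le).trans (by simp)
  have h := meas_ge_le_variance_div_sq hsum (c := n * gaussAbsMean / 2) (by positivity)
  rw [hmean] at h
  rw [← map_pi_eq_stdGaussian, Measure.map_apply (by fun_prop)
    (isClosed_le (by fun_prop) (by fun_prop)).measurableSet]
  refine le_trans ?_ (h.trans (ENNReal.ofReal_le_ofReal ?_))
  · refine measure_mono fun w hw => ?_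
    simpa using hw
  · calc _ ≤ n / (n * gaussAbsMean / 2) ^ 2 := by gcongr
      _ = _ := by field_simp; norm_num

theorem sum_abs_cos_smul_add_sin_smul_ge {a : ℝ}
    {p : EuclideanSpace ℝ (Fin n) × EuclideanSpace ℝ (Fin n)}
    (h1 : a ≤ ∑ i, |p.1 i|) (h2 : ∑ i, |p.2 i| ≤ 3 * a) {u : ℝ}
    (hu : u ∈ Set.Icc 0 (Real.pi / 16)) :
    a / 4 ≤ ∑ i, |(Real.cos u • p.1 + Real.sin u • p.2) i| := by
  have hpi := Real.pi_lt_d2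
  have hu' : u ≤ 0.197 := by linarith [hu.2]
  have hc : 0.98 ≤ Real.cos u := by nlinarith [Real.one_sub_sq_div_two_le_cos (x := u), hu.1]
  have hs : Real.sin u ≤ 0.197 := (Real.sin_le hu.1).trans hu'
  have hs0 : 0 ≤ Real.sin u :=
    Real.sin_nonneg_of_nonneg_of_le_pi hu.1 (by linarith [Real.pi_gt_three])
  have hterm : ∀ i, Real.cos u * |p.1 i| - Real.sin u * |p.2 i| ≤
      |(Real.cos u • p.1 + Real.sin u • p.2) i| := fun i => by
    have h := abs_sub_abs_le_abs_sub (Real.cos u * p.1 i) (-(Real.sin u * p.2 i))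
    rw [abs_neg, abs_mul, abs_mul, abs_of_nonneg hs0, abs_of_nonneg (by linarith : 0 ≤ Real.cos u),
      sub_neg_eq_add] at h
    simpa using h
  have hsum := Finset.sum_le_sum fun i (_ : i ∈ Finset.univ) => hterm i
  rw [Finset.sum_sub_distrib, ← Finset.mul_sum, ← Finset.mul_sum] at hsum
  have hN : 0 ≤ ∑ i, |p.2 i| := by positivity
  have ha : 0 ≤ a := by linarith
  have e1 : 0.98 * a ≤ Real.cos u * ∑ i, |p.1 i| := mul_le_mul hc h1 ha (by linarith)
  have e2 : Real.sin u * ∑ i, |p.2 i| ≤ 0.197 * (3 * a) := mul_le_mul hs h2 hN (by norm_num)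
  linarith

theorem gaussVar_radialExt_le (hn : 2 ≤ n) (hF : ContDiff ℝ 1 F)
    (hb : ∀ x ∈ Metric.sphere (0 : EuclideanSpace ℝ (Fin n)) 1, |F x| ≤ 1) :
    gaussVar (radialExt F) ≤ (16 / gaussAbsMean * ∑ i, ∑ j, sphNorm n 1 (Dang n i j F) +
      128 / gaussAbsMean ^ 2) / n := by
  set g := radialExt F with hgdef
  set γ := stdGaussian (EuclideanSpace ℝ (Fin n)) with hγ
  set S := ∑ i, ∑ j, sphNorm n 1 (Dang n i j F) with hSdef
  have hS0 : 0 ≤ S := by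
    simp only [hSdef, sphNorm_one]
    positivity
  have hm := gaussAbsMean_pos
  set m := gaussAbsMean
  have hn' : (0 : ℝ) < n := by positivity
  have hgm : Measurable g := measurable_radialExt hF.continuous
  have hg1 : ∀ x, |g x| ≤ 1 := abs_radialExt_le hb
  set D : Set (EuclideanSpace ℝ (Fin n)) := {x | n * m / 2 ≤ |∑ i, |x i| - n * m|} with hD
  have hDm : MeasurableSet D := (isClosed_le (by fun_prop) (by fun_prop)).measurableSet
  have hDP : γ D ≤ ENNReal.ofReal (4 / (m ^ 2 * n)) := stdGaussian_sum_abs_deviation_le (by omega)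
  set T : Set (EuclideanSpace ℝ (Fin n) × EuclideanSpace ℝ (Fin n)) := Dᶜ ×ˢ Dᶜ with hT
  have hTm : MeasurableSet T := hDm.compl.prod hDm.compl
  have hTc : γ.prod γ Tᶜ ≤ ENNReal.ofReal (8 / (m ^ 2 * n)) := by
    have hsub : Tᶜ ⊆ (D ×ˢ Set.univ) ∪ (Set.univ ×ˢ D) := fun p hp => by
      by_contra hcon
      simp only [Set.mem_union, Set.mem_prod, Set.mem_univ, and_true, true_and, not_or] at hcon
      exact hp ⟨hcon.1, hcon.2⟩
    refine (measure_mono hsub).trans ((measure_union_le _ _).trans ?_)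
    rw [Measure.prod_prod, Measure.prod_prod, measure_univ, mul_one, one_mul]
    refine (add_le_add hDP hDP).trans ?_
    rw [← ENNReal.ofReal_add (by positivity) (by positivity)]
    exact ENNReal.ofReal_le_ofReal (by ring_nf; rfl)
  have hmem : ∀ x ∈ Dᶜ, n * m / 2 ≤ ∑ i, |x i| ∧ ∑ i, |x i| ≤ 3 * (n * m / 2) := fun x hx => by
    have hx' : |∑ i, |x i| - n * m| < n * m / 2 := not_le.1 hx
    rw [abs_lt] at hx'
    constructor <;> linarith
  have hincr : gaussIncr g (Real.cos (Real.pi / 16)) (Real.sin (Real.pi / 16)) ≤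
      2 / (n * m) * S + 16 / (m ^ 2 * n) := by
    rw [← ENNReal.ofReal_le_ofReal_iff (by positivity), ofReal_gaussIncr hgm hg1,
      ← lintegral_add_compl _ hTm, ENNReal.ofReal_add (by positivity) (by positivity)]
    refine add_le_add ?_ ?_
    · refine (lintegral_increment_le (A := {x | n * m / 2 / 4 ≤ ∑ i, |x i|}) (by simpa using hn)
        (contDiffOn_radialExt hF) (by positivity)
        (isClosed_le (by fun_prop) (by fun_prop)).measurableSet hTm fun p hp u hu =>
          sum_abs_cos_smul_add_sin_smul_ge (hmem _ hp.1).1 (hmem _ hp.2).2 hu).trans ?_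
      refine (mul_le_mul' le_rfl (setLIntegral_fderiv_radialExt_le hn hF (by positivity))).trans ?_
      rw [← ENNReal.ofReal_mul (by positivity), ← hSdef, ← mul_assoc]
      refine ENNReal.ofReal_le_ofReal (mul_le_mul_of_nonneg_right ?_ hS0)
      calc Real.pi / 16 * (n * m / 2 / 4)⁻¹ = Real.pi / 2 * (n * m)⁻¹ := by field_simp; norm_num
        _ ≤ 2 * (n * m)⁻¹ := by gcongr; linarith [Real.pi_lt_four]
        _ = _ := by ring
    · have hle : ∀ p : EuclideanSpace ℝ (Fin n) × EuclideanSpace ℝ (Fin n),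
          ‖g p.1 - g (Real.cos (Real.pi / 16) • p.1 + Real.sin (Real.pi / 16) • p.2)‖ₑ ≤ 2 :=
        fun p => by
          rw [← ofReal_norm]
          refine ENNReal.ofReal_le_of_le_toReal ?_
          have h1 := hg1 p.1
          have h2 := hg1 (Real.cos (Real.pi / 16) • p.1 + Real.sin (Real.pi / 16) • p.2)
          exact (abs_sub _ _).trans (by rw [ENNReal.toReal_ofNat]; linarith)
      refine (lintegral_mono hle).trans ?_
      rw [setLIntegral_const]
      refine (mul_le_mul' le_rfl hTc).trans ?_
      rw [← ENNReal.ofReal_ofNat 2, ← ENNReal.ofReal_mul (by norm_num)]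
      exact ENNReal.ofReal_le_ofReal (by ring_nf; rfl)
  have d1 := gaussIncr_double hgm hg1 (Real.pi / 16)
  have d2 := gaussIncr_double hgm hg1 (Real.pi / 8)
  have d3 := gaussIncr_double hgm hg1 (Real.pi / 4)
  rw [show 2 * (Real.pi / 16) = Real.pi / 8 by ring] at d1
  rw [show 2 * (Real.pi / 8) = Real.pi / 4 by ring] at d2
  rw [show 2 * (Real.pi / 4) = Real.pi / 2 by ring, Real.cos_pi_div_two, Real.sin_pi_div_two] at d3
  have hV := gaussVar_le_gaussIncr hgm hg1
  calc gaussVar g ≤ 8 * (2 / (n * m) * S + 16 / (m ^ 2 * n)) := by linarith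
    _ = _ := by field_simp; ring

end Sphere

theorem half_sum_div_sqrt_log_le {ι : Type*} [Fintype ι] [Nonempty ι] {d : ι → ℝ}
    (hd : ∀ i, 0 ≤ d i) (hS : 0 < ∑ i, d i) :
    (∑ i, d i) / 2 / √(1 + max (Real.log (2 * Fintype.card ι / ∑ i, d i)) 0) ≤
      ∑ i, d i * (1 + d i) / √(1 + max (Real.log (1 / d i)) 0) := by
  set S := ∑ i, d i with hSdef
  set N : ℝ := (Fintype.card ι : ℝ) with hN
  have hN0 : 0 < N := by
    have := Fintype.card_pos (α := ι)
    positivity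
  set L := max (Real.log (2 * N / S)) 0
  have hL : 0 ≤ L := le_max_right _ _
  have hterm : ∀ i, (d i - S / (2 * N)) / √(1 + L) ≤
      d i * (1 + d i) / √(1 + max (Real.log (1 / d i)) 0) := fun i => by
    have hi := hd i
    rcases le_or_gt (S / (2 * N)) (d i) with h | h
    · have hpos : 0 < d i := (by positivity : 0 < S / (2 * N)).trans_le h
      have hlog : Real.log (1 / d i) ≤ Real.log (2 * N / S) := by
        refine Real.log_le_log (by positivity) ?_
        rw [← one_div_div S]
        exact one_div_le_one_div_of_le (by positivity) h
      have hsq : √(1 + max (Real.log (1 / d i)) 0) ≤ √(1 + L) :=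
        Real.sqrt_le_sqrt (add_le_add le_rfl (max_le_max hlog le_rfl))
      have hq : 0 < √(1 + max (Real.log (1 / d i)) 0) :=
        Real.sqrt_pos.2 (by linarith [le_max_right (Real.log (1 / d i)) 0])
      refine div_le_div₀ (by positivity) ?_ hq hsq
      nlinarith [(by positivity : 0 < S / (2 * N))]
    · refine (div_nonpos_of_nonpos_of_nonneg (by linarith) (Real.sqrt_nonneg _)).trans ?_
      positivity
  refine le_trans (le_of_eq ?_) (Finset.sum_le_sum fun i _ => hterm i)
  rw [← Finset.sum_div, Finset.sum_sub_distrib, ← hSdef, Finset.sum_const, Finset.card_univ,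
    nsmul_eq_mul, ← hN]
  congr 1
  field_simp
  norm_num

theorem one_add_log_le_of_le_one {n : ℕ} (hn : 2 ≤ n) {S : ℝ} (hS : 0 < S) (hS1 : S ≤ 1) :
    1 + max (Real.log (2 * (n ^ 2 : ℝ) / S)) 0 ≤
      9 * (1 + max (Real.log (1 / (2 / √n * S))) 0) := by
  have hn' : (0 : ℝ) < n := by positivity
  have hG : 0 < 1 / (2 / √n * S) := by positivity
  have h1 : 2 * (n ^ 2 : ℝ) / S ≤ 2 ^ 5 * (1 / (2 / √n * S)) ^ 4 := by
    have hsq : √(n : ℝ) ^ 4 = n ^ 2 := by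
      rw [show 4 = 2 * 2 by norm_num, pow_mul, Real.sq_sqrt hn'.le]
    have : 2 ^ 5 * (1 / (2 / √n * S)) ^ 4 = 2 * (n ^ 2 : ℝ) / S ^ 4 := by
      rw [← hsq]
      field_simp
    rw [this]
    exact div_le_div_of_nonneg_left (by positivity) (by positivity)
      (pow_le_of_le_one hS.le hS1 (by norm_num))
  have h2 := Real.log_le_log (by positivity) h1
  rw [Real.log_mul (by positivity) (by positivity), Real.log_pow, Real.log_pow] at h2
  have h3 := Real.log_two_lt_d9
  have h4 := le_max_left (Real.log (1 / (2 / √n * S))) 0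
  have h5 := le_max_right (Real.log (1 / (2 / √n * S))) 0
  push_cast at h2
  have : max (Real.log (2 * (n ^ 2 : ℝ) / S)) 0 ≤
      4 + 4 * max (Real.log (1 / (2 / √n * S))) 0 := max_le (by linarith) (by linarith)
  linarith

theorem one_add_log_le_of_one_lt {n : ℕ} (hn : 2 ≤ n) {S : ℝ} (hS : 1 < S) :
    1 + max (Real.log (2 * (n ^ 2 : ℝ) / S)) 0 ≤ 9 * n := by
  have hn' : (2 : ℝ) ≤ n := by exact_mod_cast hn
  have h1 : Real.log (2 * (n ^ 2 : ℝ) / S) ≤ Real.log (2 * (n ^ 2 : ℝ)) :=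
    Real.log_le_log (by positivity) (div_le_self (by positivity) hS.le)
  rw [Real.log_mul (by norm_num) (by positivity), Real.log_pow] at h1
  have h2 := Real.log_le_self (x := n) (by linarith)
  have h3 := Real.log_two_lt_d9
  push_cast at h1
  have : max (Real.log (2 * (n ^ 2 : ℝ) / S)) 0 ≤ 1 + 2 * n := max_le (by linarith) (by linarith)
  linarith

theorem sphVar_le {n : ℕ} (hn : 2 ≤ n) {F : EuclideanSpace ℝ (Fin n) → ℝ} (hF : ContDiff ℝ 1 F)
    (hb : ∀ x ∈ Metric.sphere (0 : EuclideanSpace ℝ (Fin n)) 1, |F x| ≤ 1) {S : ℝ}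
    (hSdef : S = ∑ i, ∑ j, sphNorm n 1 (Dang n i j F)) (hS : 0 < S) :
    sphVar n F ≤ (120000 + 6 * (16 / gaussAbsMean + 128 / gaussAbsMean ^ 2)) / √n *
      (S / 2 / √(1 + max (Real.log (2 * (n ^ 2 : ℝ) / S)) 0)) := by
  have hn' : (0 : ℝ) < n := by positivity
  have hm := gaussAbsMean_pos
  rw [sphVar_eq_gaussVar hn hF.continuous]
  set Q := 1 + max (Real.log (2 * (n ^ 2 : ℝ) / S)) 0 with hQ
  have hQ0 : 0 < Q := by linarith [le_max_right (Real.log (2 * (n ^ 2 : ℝ) / S)) 0]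
  have h9 : √(9 : ℝ) = 3 := by
    rw [show (9 : ℝ) = 3 ^ 2 by norm_num, Real.sqrt_sq (by norm_num)]
  set K := 16 / gaussAbsMean + 128 / gaussAbsMean ^ 2 with hK
  have hK0 : 0 < K := by positivity
  rcases le_or_gt S 1 with hS1 | hS1
  · have h := gaussVar_le_of_gaussIncr_le (measurable_radialExt hF.continuous)
      (abs_radialExt_le hb) (G := 2 / √n * S) (by positivity) fun α hα _ => by
        rw [hSdef]
        exact gaussIncr_radialExt_le hn hF hb hα
    have hR := one_add_log_le_of_le_one hn hS hS1
    rw [← hQ] at hR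
    set R := 1 + max (Real.log (1 / (2 / √n * S))) 0 with hRdef
    have hR0 : 0 < R := by linarith
    have hsqrt : √Q ≤ 3 * √R := by
      rw [← h9, ← Real.sqrt_mul (by norm_num)]
      exact Real.sqrt_le_sqrt hR
    have hinv : 1 / √R ≤ 3 / √Q := by
      rw [div_le_div_iff₀ (by positivity) (by positivity)]
      linarith
    calc _ ≤ 10000 * (2 / √n * S) / √R := h
      _ = 20000 / √n * S * (1 / √R) := by ring
      _ ≤ 20000 / √n * S * (3 / √Q) := by gcongr
      _ = 120000 / √n * (S / 2 / √Q) := by ring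
      _ ≤ _ := by
        gcongr
        linarith
  · have h := gaussVar_radialExt_le hn hF hb
    rw [← hSdef] at h
    have hR := one_add_log_le_of_one_lt hn hS1
    rw [← hQ] at hR
    have hsqrt : √Q ≤ 3 * √n := by
      rw [← h9, ← Real.sqrt_mul (by norm_num)]
      exact Real.sqrt_le_sqrt hR
    have hinv : 1 / √n ≤ 3 / √Q := by
      rw [div_le_div_iff₀ (by positivity) (by positivity)]
      linarith
    have hKS : 16 / gaussAbsMean * S + 128 / gaussAbsMean ^ 2 ≤ K * S := by
      rw [hK, add_mul]
      have : 0 < 128 / gaussAbsMean ^ 2 := by positivity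
      nlinarith
    calc _ ≤ K * S / n := h.trans (by gcongr)
      _ = K / √n * S * (1 / √n) := by
        conv_lhs => rw [← Real.mul_self_sqrt hn'.le]
        field_simp
      _ ≤ K / √n * S * (3 / √Q) := by gcongr
      _ = 6 * K / √n * (S / 2 / √Q) := by ring
      _ ≤ _ := by
        gcongr
        linarith

end SphereTalagrand

/-- The `L¹` (geometric-influence) form of Talagrand's inequality on the sphere
`𝕊^{n-1}`; smooth functions on the sphere are given as restrictions of smooth
functions `F` on `ℝ^n`. -/
theorem stmt13 :
    ∃ C : ℝ, 0 < C ∧ ∀ n : ℕ, 2 ≤ n → ∀ F : EuclideanSpace ℝ (Fin n) → ℝ,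
      ContDiff ℝ (⊤ : ℕ∞) F → (∀ x ∈ Metric.sphere (0 : EuclideanSpace ℝ (Fin n)) 1, |F x| ≤ 1) →
      sphVar n F ≤ (C / Real.sqrt n) * ∑ i : Fin n, ∑ j : Fin n,
        sphNorm n 1 (Dang n i j F) * (1 + sphNorm n 1 (Dang n i j F)) /
          Real.sqrt (1 + max (Real.log (1 / sphNorm n 1 (Dang n i j F))) 0) := by
  have hm := gaussAbsMean_pos
  refine ⟨120000 + 6 * (16 / gaussAbsMean + 128 / gaussAbsMean ^ 2), by positivity,
    fun n hn F hF hb => ?_⟩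
  have hF1 : ContDiff ℝ 1 F := hF.of_le (by exact_mod_cast le_top)
  have hd : ∀ i j, 0 ≤ sphNorm n 1 (Dang n i j F) := fun i j => by
    rw [sphNorm_one]
    positivity
  set S := ∑ i, ∑ j, sphNorm n 1 (Dang n i j F) with hSdef
  have hS0 : 0 ≤ S := Finset.sum_nonneg fun i _ => Finset.sum_nonneg fun j _ => hd i j
  rcases hS0.eq_or_lt with hS | hS
  · have h1 := gaussIncr_radialExt_le hn hF1 hb (α := Real.pi / 2) (by positivity)
    rw [← hSdef, ← hS, mul_zero, mul_zero, Real.cos_pi_div_two, Real.sin_pi_div_two] at h1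
    have h2 := gaussVar_le_gaussIncr (measurable_radialExt hF1.continuous) (abs_radialExt_le hb)
    rw [sphVar_eq_gaussVar hn hF1.continuous]
    refine (h2.trans h1).trans (mul_nonneg (by positivity) ?_)
    exact Finset.sum_nonneg fun i _ => Finset.sum_nonneg fun j _ =>
      div_nonneg (mul_nonneg (hd i j) (by linarith [hd i j])) (Real.sqrt_nonneg _)
  · refine (sphVar_le hn hF1 hb hSdef hS).trans ?_
    refine mul_le_mul_of_nonneg_left ?_ (by positivity)
    have : Nonempty (Fin n) := ⟨⟨0, by omega⟩⟩
    have h := half_sum_div_sqrt_log_le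
      (d := fun p : Fin n × Fin n => sphNorm n 1 (Dang n p.1 p.2 F)) (fun p => hd p.1 p.2)
      (by rw [Fintype.sum_prod_type]; exact hS)
    rw [Fintype.sum_prod_type, Fintype.sum_prod_type, ← hSdef, Fintype.card_prod, Fintype.card_fin,
      Nat.cast_mul, ← sq] at h
    exact h
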